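/- arXiv:2304.13213 — 11 statements merged into one kernel-verified Lean document; each statement's English description precedes it below -/
import Mathlib

section
/- Let p be an odd prime, q a power of p, and d > 1 a divisor of (q-1)/2. Let N = ω(GP(q,d)) be the clique number of the d-Paley graph GP(q,d). If n is an integer with 2 ≤ n ≤ N such that the binomial coefficient C(n - 1 + (q-1)/d, (q-1)/d) is not congruent to 0 modulo p, then (N-1)·n ≤ (q-1)/d. -/
/-- A subset `C` of the field `F` is a clique of the `d`-Paley graph `GP(F,d)`:
all pairwise differences of distinct elements are nonzero `d`-th powers. -/
def IsPaleyClique (F : Type*) [Field F] (d : ℕ) (C : Set F) : Prop :=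
  ∀ x ∈ C, ∀ y ∈ C, x ≠ y → ∃ z : F, z ≠ 0 ∧ x - y = z ^ d

/-- The clique number of the `d`-Paley graph on `F`: the maximum size of a clique. -/
noncomputable def paleyCliqueNumber (F : Type*) [Field F] (d : ℕ) : ℕ :=
  sSup {n : ℕ | ∃ C : Set F, IsPaleyClique F d C ∧ C.ncard = n}

open Polynomial in
/-- There are weights on a finite set `B` of field elements that extract from a polynomial of
degree below `#B` its coefficient of index `#B - 1`. In particular they annihilate the powers
`(a - b) ^ k` with `k < #B - 1`. -/
theorem exists_weights_sum_sub_pow {F : Type*} [Field F] (B : Finset F) (hB : B.Nonempty) :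
    ∃ c : F → F, ∀ (a : F) (k : ℕ), k ≤ B.card - 1 →
      ∑ b ∈ B, c b * (a - b) ^ k = if k = B.card - 1 then (-1) ^ (B.card - 1) else 0 := by
  classical
  have hpos : 0 < B.card := hB.card_pos
  refine ⟨fun b => (∏ j ∈ B.erase b, (b - j))⁻¹, fun a k hk => ?_⟩
  have hdeg : ((X - C a) ^ k : F[X]).degree < B.card := by
    rw [degree_pow, degree_X_sub_C, nsmul_one]
    exact_mod_cast (by omega : k < B.card)
  have h := Lagrange.coeff_eq_sum (s := B) (v := id) Function.injective_id.injOn hdeg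
  have hmonic : ((X - C a) ^ k : F[X]).coeff (B.card - 1) =
      if k = B.card - 1 then 1 else 0 := by
    have hnat : ((X - C a) ^ k : F[X]).natDegree = k := by simp
    split_ifs with hkB
    · rw [← hkB]
      have := ((monic_X_sub_C a).pow k).coeff_natDegree
      rwa [hnat] at this
    · exact coeff_eq_zero_of_natDegree_lt (by omega)
  rw [hmonic] at h
  have hsum : ∑ b ∈ B, (∏ j ∈ B.erase b, (b - j))⁻¹ * (a - b) ^ k =
      (-1) ^ k * ∑ b ∈ B, eval (id b) ((X - C a) ^ k) / ∏ j ∈ B.erase b, (id b - id j) := by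
    rw [Finset.mul_sum]
    refine Finset.sum_congr rfl fun b _ => ?_
    rw [show a - b = -1 * (b - a) by ring, mul_pow]
    simp only [eval_pow, eval_sub, eval_X, eval_C, id, div_eq_mul_inv]
    ring
  rw [hsum, ← h]
  split_ifs with hkB
  · rw [mul_one, hkB]
  · rw [mul_zero]

open Polynomial in
/-- Stepanov's method: if the differences of distinct elements of `A` are `m`-th roots of unity,
then the size of `A` is bounded in terms of any subset `B` with nonvanishing binomial
coefficient. -/
theorem card_sub_one_mul_card_le {F : Type*} [Field F] (A B : Finset F) (hBA : B ⊆ A) (m : ℕ)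
    (hm : 0 < m) (hB : 2 ≤ B.card)
    (hA : ∀ a ∈ A, ∀ b ∈ A, a ≠ b → (a - b) ^ m = 1)
    (hbin : ((B.card - 1 + m).choose m : F) ≠ 0) :
    (A.card - 1) * B.card ≤ m := by
  classical
  obtain ⟨c, hc⟩ := exists_weights_sum_sub_pow B (Finset.card_pos.mp (by omega))
  set n := B.card with hn
  set M := n - 1 + m with hM
  let f : F[X] := ∑ b ∈ B, C (c b) * (X - C b) ^ M - C ((-1) ^ (n - 1))
  have htaylor (a : F) (j : ℕ) : (taylor a f).coeff j =
      (∑ b ∈ B, c b * (a - b) ^ (M - j)) * (M.choose j : F) -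
        if j = 0 then (-1) ^ (n - 1) else 0 := by
    simp only [f, map_sub, map_sum, taylor_mul, taylor_C, taylor_pow, taylor_X, coeff_sub,
      finsetSum_coeff, coeff_C_mul, coeff_C, Finset.sum_mul]
    congr 1
    refine Finset.sum_congr rfl fun b _ => ?_
    rw [add_sub_assoc, ← C_sub, coeff_X_add_C_pow, mul_assoc]
  have hcoeff (j : ℕ) : f.coeff j =
      (∑ b ∈ B, c b * (0 - b) ^ (M - j)) * (M.choose j : F) -
        if j = 0 then (-1) ^ (n - 1) else 0 := by
    simpa only [taylor_zero] using htaylor 0 j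
  have hfm : f.coeff m ≠ 0 := by
    rw [hcoeff, hc 0 (M - m) (by omega), if_pos (by omega), if_neg (by omega), sub_zero]
    exact mul_ne_zero (pow_ne_zero _ (neg_ne_zero.mpr one_ne_zero)) hbin
  have hf0 : f ≠ 0 := fun h => hfm (by rw [h, coeff_zero])
  have hdeg : f.natDegree ≤ m := by
    refine natDegree_le_iff_coeff_eq_zero.mpr fun j hj => ?_
    rw [hcoeff, if_neg (by omega : j ≠ 0), sub_zero]
    rcases le_or_gt j M with hjM | hjM
    · rw [hc 0 (M - j) (by omega), if_neg (by omega), zero_mul]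
    · rw [Nat.choose_eq_zero_of_lt hjM, Nat.cast_zero, mul_zero]
  have hvanish (a : F) (ha : a ∈ A) (j : ℕ) (hj : j < n) (hjB : a ∈ B → j + 1 < n) :
      (taylor a f).coeff j = 0 := by
    have hsum : ∑ b ∈ B, c b * (a - b) ^ (M - j) = ∑ b ∈ B, c b * (a - b) ^ (n - 1 - j) := by
      refine Finset.sum_congr rfl fun b hb => ?_
      by_cases hab : a = b
      · subst hab
        have := hjB hb
        rw [sub_self, zero_pow (by omega), zero_pow (by omega)]
      · rw [show M - j = n - 1 - j + m by omega, pow_add, hA a ha b (hBA hb) hab, mul_one]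
    rw [htaylor, hsum, hc a _ (by omega)]
    by_cases hj0 : j = 0
    · subst hj0
      simp
    · rw [if_neg (by omega), if_neg hj0, zero_mul, sub_zero]
  let e : F → ℕ := fun a => if a ∈ B then n - 1 else n
  have hdvd : ∏ a ∈ A, (X - C a) ^ e a ∣ f := by
    refine Finset.prod_dvd_of_coprime ?_ fun a ha => ?_
    · exact fun a _ b _ hab => (pairwise_coprime_X_sub_C Function.injective_id hab).pow
    · rw [X_sub_C_pow_dvd_iff, ← taylor_apply, X_pow_dvd_iff]
      intro j hj
      by_cases haB : a ∈ B
      · simp only [e, if_pos haB] at hj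
        exact hvanish a ha j (by omega) fun _ => by omega
      · simp only [e, if_neg haB] at hj
        exact hvanish a ha j hj fun h => absurd h haB
  have hle := (natDegree_le_of_dvd hdvd hf0).trans hdeg
  rw [natDegree_prod_of_monic _ _ fun a _ => (monic_X_sub_C a).pow _] at hle
  simp only [natDegree_pow, natDegree_X_sub_C, mul_one] at hle
  have hsum : ∑ a ∈ A, e a = (A.card - n) * n + n * (n - 1) := by
    rw [← Finset.sum_sdiff hBA, Finset.sum_congr rfl fun a ha => if_neg (Finset.mem_sdiff.mp ha).2,
      Finset.sum_congr (s₁ := B) rfl fun a ha => if_pos ha, Finset.sum_const, Finset.sum_const,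
      Finset.card_sdiff_of_subset hBA, smul_eq_mul, smul_eq_mul]
  have hcard : n ≤ A.card := Finset.card_le_card hBA
  calc (A.card - 1) * n = (A.card - n) * n + n * (n - 1) := by
        rw [mul_comm n (n - 1), ← add_mul]
        congr 1
        omega
    _ ≤ m := hsum ▸ hle

/-- The clique number of a Paley graph over a finite field is attained. -/
theorem exists_isPaleyClique_card_eq (F : Type*) [Field F] [Fintype F] (d : ℕ) :
    ∃ A : Finset F, IsPaleyClique F d A ∧ A.card = paleyCliqueNumber F d := by
  classical
  obtain ⟨S, hS, hcard⟩ : paleyCliqueNumber F d ∈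
      {n : ℕ | ∃ S : Set F, IsPaleyClique F d S ∧ S.ncard = n} := by
    refine Nat.sSup_mem ⟨0, ∅, by simp [IsPaleyClique], Set.ncard_empty F⟩
      ⟨Nat.card F, ?_⟩
    rintro _ ⟨S, -, rfl⟩
    exact Set.ncard_le_card S
  refine ⟨S.toFinset, by rwa [Set.coe_toFinset], ?_⟩
  rw [← hcard, Set.ncard_eq_toFinset_card']

theorem stmt0 (p : ℕ) (hp : p.Prime) (hodd : Odd p)
    (q : ℕ) (hq : ∃ k : ℕ, 0 < k ∧ q = p ^ k)
    (d : ℕ) (hd : 1 < d) (hdvd : d ∣ (q - 1) / 2)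
    (F : Type*) [Field F] [Fintype F] (hF : Fintype.card F = q)
    (N : ℕ) (hN : N = paleyCliqueNumber F d)
    (n : ℕ) (hn2 : 2 ≤ n) (hnN : n ≤ N)
    (hbin : ¬ (p ∣ Nat.choose (n - 1 + (q - 1) / d) ((q - 1) / d))) :
    (N - 1) * n ≤ (q - 1) / d := by
  obtain ⟨k, hk, rfl⟩ := hq
  have : Fact p.Prime := ⟨hp⟩
  have : CharP F p := charP_of_card_eq_prime_pow hF
  have hq1 : 1 < p ^ k := Nat.one_lt_pow hk.ne' hp.one_lt
  have heven : 2 ∣ p ^ k - 1 := (Nat.Odd.sub_odd hodd.pow odd_one).two_dvd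
  have hdq : d ∣ p ^ k - 1 := hdvd.trans (Nat.div_dvd_of_dvd heven)
  obtain ⟨A, hA, hcard⟩ := exists_isPaleyClique_card_eq F d
  rw [← hN] at hcard
  subst hcard
  obtain ⟨B, hBA, rfl⟩ := Finset.exists_subset_card_eq hnN
  refine card_sub_one_mul_card_le A B hBA _
    (Nat.div_pos (Nat.le_of_dvd (by omega) hdq) (by omega)) hn2 (fun a ha b hb hab => ?_)
    fun h => hbin ((CharP.cast_eq_zero_iff F p _).mp h)
  obtain ⟨z, hz, hzd⟩ := hA a ha b hb hab
  rw [hzd, ← pow_mul, Nat.mul_div_cancel' hdq, ← hF]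
  exact FiniteField.pow_card_sub_one_eq_one z hz
end

section
/- Let p be an odd prime, r a non-negative integer, q = p^{2r+1}, and d ≥ 2 an integer with q ≡ 1 (mod 2d). Then ω(GP(q,d)) ≤ max{ p^r , p^r/2 + sqrt( (q-1)/d + (p^r/2 - 1)^2 ) }, where the second expression is a real number. -/
open Polynomial in
/-- The divided difference of `(b - x) ^ j` over a set of more than `j` nodes. -/
lemma sum_nodalWeight_mul_sub_pow {F : Type*} [Field F] [DecidableEq F] {A : Finset F} {l : ℕ}
    (hA : A.card = l + 1) (b : F) {j : ℕ} (hj : j ≤ l) :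
    ∑ a ∈ A, Lagrange.nodalWeight A id a * (b - a) ^ j = if j = l then (-1) ^ l else 0 := by
  have hdeg : ((X - C b : F[X]) ^ j).degree = j := by
    rw [degree_pow, degree_X_sub_C]; simp
  have h := Lagrange.coeff_eq_sum (s := A) (v := id) Function.injective_id.injOn
    (P := (X - C b) ^ j) (by rw [hdeg, hA]; exact_mod_cast Nat.lt_succ_of_le hj)
  have hsum : ∑ a ∈ A, Lagrange.nodalWeight A id a * (b - a) ^ j =
      (-1) ^ j * ((X - C b : F[X]) ^ j).coeff l := by
    rw [hA, Nat.add_sub_cancel] at h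
    rw [h, Finset.mul_sum]
    refine Finset.sum_congr rfl fun a _ => ?_
    rw [Lagrange.nodalWeight, Finset.prod_inv_distrib, ← neg_sub a b, neg_pow]
    simp only [eval_pow, eval_sub, eval_X, eval_C, id]
    ring
  rw [hsum]
  split_ifs with hjl
  · subst hjl
    have hmonic : ((X - C b : F[X]) ^ j).Monic := (monic_X_sub_C b).pow j
    have hcoeff := hmonic.coeff_natDegree
    rw [natDegree_eq_of_degree_eq_some hdeg] at hcoeff
    rw [hcoeff, mul_one]
  · rw [coeff_eq_zero_of_degree_lt, mul_zero]
    rw [hdeg]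
    exact_mod_cast lt_of_le_of_ne hj hjl

open Polynomial in
/-- Stepanov's method for sets all of whose nonzero differences are `m`-th roots of unity. -/
lemma card_mul_card_sub_one_le_of_sub_pow_eq_one {F : Type*} [Field F] {S A : Finset F} {l m : ℕ}
    (hm : 0 < m) (hC : ∀ x ∈ S, ∀ y ∈ S, x ≠ y → (x - y) ^ m = 1)
    (hAC : A ⊆ S) (hA : A.card = l + 1) (hchoose : (((m + l).choose l : ℕ) : F) ≠ 0) :
    (l + 1) * (S.card - 1) ≤ m := by
  classical
  set c : F → F := Lagrange.nodalWeight A id with hc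
  set f : F[X] := ∑ a ∈ A, C (c a) * (X + C (-a)) ^ (m + l) - C ((-1) ^ l) with hf
  have hcoeff (k : ℕ) : f.coeff k =
      (∑ a ∈ A, c a * (0 - a) ^ (m + l - k)) * ((m + l).choose k : ℕ) -
        if k = 0 then (-1) ^ l else 0 := by
    simp [hf, finsetSum_coeff, coeff_X_add_C_pow, coeff_C, Finset.sum_mul, mul_assoc,
      -map_neg, -map_pow]
  have hcomp (b : F) (k : ℕ) : (f.comp (X + C b)).coeff k =
      (∑ a ∈ A, c a * (b - a) ^ (m + l - k)) * ((m + l).choose k : ℕ) -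
        if k = 0 then (-1) ^ l else 0 := by
    have : f.comp (X + C b) =
        ∑ a ∈ A, C (c a) * (X + C (b - a)) ^ (m + l) - C ((-1) ^ l) := by
      simp [hf, sub_eq_add_neg, add_assoc]
    rw [this]
    simp [finsetSum_coeff, coeff_X_add_C_pow, coeff_C, Finset.sum_mul, mul_assoc,
      -map_neg, -map_pow, -map_sub]
  have hdeg : f.natDegree ≤ m := by
    rw [natDegree_le_iff_coeff_eq_zero]
    intro k hk
    rw [hcoeff, if_neg (by omega), sum_nodalWeight_mul_sub_pow hA 0 (by omega)]
    rcases Nat.lt_or_ge (m + l) k with h | h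
    · simp [Nat.choose_eq_zero_of_lt h]
    · rw [if_neg (by omega)]; simp
  have hf0 : f ≠ 0 := by
    intro h0
    have h := hcoeff m
    rw [h0, coeff_zero, if_neg hm.ne', sum_nodalWeight_mul_sub_pow hA 0 (by omega),
      if_pos (by omega), Nat.choose_symm_add, sub_zero] at h
    exact mul_ne_zero (pow_ne_zero _ (neg_ne_zero.2 one_ne_zero)) hchoose h.symm
  have hvanish {b : F} (hb : b ∈ S) {k : ℕ} (hk : k < l ∨ k = l ∧ b ∉ A) :
      (f.comp (X + C b)).coeff k = 0 := by
    have hsum : ∑ a ∈ A, c a * (b - a) ^ (m + l - k) = ∑ a ∈ A, c a * (b - a) ^ (l - k) := by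
      refine Finset.sum_congr rfl fun a ha => ?_
      congr 1
      by_cases hba : b = a
      · subst hba
        have hkl : k < l := hk.resolve_right fun h => h.2 ha
        rw [sub_self, zero_pow (by omega), zero_pow (by omega)]
      · rw [show m + l - k = m + (l - k) by omega, pow_add, hC b hb a (hAC ha) hba, one_mul]
    rw [hcomp, hsum, sum_nodalWeight_mul_sub_pow hA b (by omega)]
    by_cases hk0 : k = 0
    · subst hk0; simp
    · rw [if_neg (by omega), if_neg hk0]; simp
  have hdvd : ∏ b ∈ S, (X - C b) ^ (if b ∈ A then l else l + 1) ∣ f := by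
    refine Finset.prod_dvd_of_coprime (fun a _ b _ hab => ?_) fun b hb => ?_
    · exact (pairwise_coprime_X_sub_C Function.injective_id hab).pow
    · rw [X_sub_C_pow_dvd_iff, X_pow_dvd_iff]
      intro k hk
      refine hvanish hb ?_
      split_ifs at hk with hbA
      · exact Or.inl hk
      · rcases Nat.lt_succ_iff_lt_or_eq.1 hk with h | h
        · exact Or.inl h
        · exact Or.inr ⟨h, hbA⟩
  have hle := (natDegree_le_of_dvd hdvd hf0).trans hdeg
  rw [natDegree_prod_of_monic _ _ fun b _ => (monic_X_sub_C b).pow _] at hle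
  have hexp (b : F) : (if b ∈ A then l else l + 1) + (if b ∈ A then 1 else 0) = l + 1 := by
    split_ifs <;> rfl
  have htotal : ∑ b ∈ S, (if b ∈ A then l else l + 1) + (l + 1) = S.card * (l + 1) := by
    have h := Finset.sum_congr (rfl : S = S) fun b _ => hexp b
    rw [Finset.sum_add_distrib, Finset.sum_const, smul_eq_mul, ← Finset.card_filter,
      Finset.filter_mem_eq_inter, Finset.inter_eq_right.2 hAC, hA] at h
    exact h
  simp only [natDegree_pow, natDegree_X_sub_C, mul_one] at hle
  rw [Nat.mul_sub, mul_one, mul_comm]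
  omega

/-- If no carry occurs when adding `m` and `l` in base `p`, then `p` does not divide
`(m + l).choose l`. -/
lemma not_dvd_choose_of_forall_mod_add_mod_lt {p m l : ℕ} (hp : p.Prime)
    (h : ∀ i, 1 ≤ i → l % p ^ i + m % p ^ i < p ^ i) : ¬ p ∣ (m + l).choose l := by
  intro hdvd
  have hfac := Nat.factorization_choose' hp (Nat.lt_succ_self (Nat.log p (m + l)))
  rw [Finset.card_eq_zero.2 (Finset.filter_eq_empty_iff.2 fun i hi =>
    not_le.2 (h i (Finset.mem_Ico.1 hi).1))] at hfac
  exact (hp.factorization_pos_of_dvd (Nat.choose_pos (Nat.le_add_left l m)).ne' hdvd).ne' hfac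

/-- Adding the complement of the last `s` digits of `m` causes no carry beyond the last `s`
digits. -/
lemma complement_add_mod_lt {p m s i : ℕ} (hp : 0 < p) (hi : s ≤ i) :
    p ^ s - 1 - m % p ^ s + m % p ^ i < p ^ i := by
  obtain ⟨j, rfl⟩ := Nat.exists_eq_add_of_le hi
  have hs : 0 < p ^ s := by positivity
  have hj : 0 < p ^ j := by positivity
  have h1 := Nat.mod_lt m hs
  have h2 := Nat.mod_lt (m / p ^ s) hj
  rw [pow_add, Nat.mod_mul]
  have h3 : p ^ s * (m / p ^ s % p ^ j + 1) ≤ p ^ s * p ^ j := Nat.mul_le_mul_left _ h2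
  rw [mul_add, mul_one] at h3
  omega

/-- Adding the complement of the last `s` digits of `m` to `m` causes no carry among those
digits. -/
lemma complement_mod_add_mod_lt {p m s i : ℕ} (hp : 0 < p) (hi : i ≤ s) :
    (p ^ s - 1 - m % p ^ s) % p ^ i + m % p ^ i < p ^ i := by
  obtain ⟨j, rfl⟩ := Nat.exists_eq_add_of_le hi
  have hs : 0 < p ^ i := by positivity
  have hj : 0 < p ^ j := by positivity
  have h1 := Nat.mod_lt m hs
  have h2 := Nat.mod_lt (m / p ^ i) hj
  have h4 : p ^ (i + j) - 1 - m % p ^ (i + j) =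
      (p ^ i - 1 - m % p ^ i) + p ^ i * (p ^ j - 1 - m / p ^ i % p ^ j) := by
    rw [pow_add, Nat.mod_mul]
    generalize m / p ^ i % p ^ j = w at *
    obtain ⟨t, ht⟩ := Nat.exists_eq_add_of_lt h2
    rw [ht, show w + t + 1 - 1 - w = t by omega,
      show p ^ i * (w + t + 1) = p ^ i * w + p ^ i * t + p ^ i by ring]
    omega
  rw [h4, Nat.add_mul_mod_self_left]
  generalize m % p ^ i = v at h1 ⊢
  rw [Nat.mod_eq_of_lt (by omega)]
  omega

/-- A clique with more than `p ^ r` elements in the `d`-Paley graph on `p ^ (2 * r + 1)` vertices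
satisfies a quadratic inequality. -/
lemma IsPaleyClique.card_bound {F : Type*} [Field F] [Fintype F] {p r d m : ℕ} (hp : p.Prime)
    (hF : Fintype.card F = p ^ (2 * r + 1)) (hd : 2 ≤ d) (hm : p ^ (2 * r + 1) = m * d + 1)
    (hm0 : 0 < m) {C : Finset F} (hC : IsPaleyClique F d C) (hr : p ^ r < C.card) :
    (C.card - p ^ r + 1) * (C.card - 1) ≤ m := by
  have : Fact p.Prime := ⟨hp⟩
  have : CharP F p := charP_of_card_eq_prime_pow hF
  have hpow : ∀ x ∈ C, ∀ y ∈ C, x ≠ y → (x - y) ^ m = 1 := by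
    intro x hx y hy hxy
    obtain ⟨z, hz, h⟩ := hC x hx y hy hxy
    rw [h, ← pow_mul, mul_comm, show m * d = Fintype.card F - 1 by omega,
      FiniteField.pow_card_sub_one_eq_one z hz]
  have key {l : ℕ} (hl : l < C.card) (hcarry : ∀ i, 1 ≤ i → l % p ^ i + m % p ^ i < p ^ i) :
      (l + 1) * (C.card - 1) ≤ m := by
    obtain ⟨A, hAC, hA⟩ := Finset.exists_subset_card_eq (show l + 1 ≤ C.card from hl)
    refine card_mul_card_sub_one_le_of_sub_pow_eq_one hm0 hpow hAC hA ?_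
    rw [Ne, CharP.cast_eq_zero_iff F p]
    exact not_dvd_choose_of_forall_mod_add_mod_lt hp hcarry
  have hpr : 0 < p ^ r := pow_pos hp.pos r
  have hps : 0 < p ^ (r + 1) := pow_pos hp.pos _
  set c := p ^ (r + 1) - 1 - m % p ^ (r + 1) with hc
  have hv := Nat.mod_lt m hps
  rcases Nat.lt_or_ge c C.card with hcN | hcN
  · exfalso
    have hle := key hcN fun i hi => by
      rcases le_total i (r + 1) with h | h
      · exact complement_mod_add_mod_lt hp.pos h
      · exact (Nat.add_le_add_right (Nat.mod_le _ _) _).trans_lt (complement_add_mod_lt hp.pos h)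
    have h1 : (c + 1) * p ^ r ≤ m := (Nat.mul_le_mul_left _ (by omega)).trans hle
    have h2 := Nat.div_add_mod m (p ^ (r + 1))
    have hq : p ^ r * p ^ (r + 1) = m * d + 1 := by rw [← hm, ← pow_add]; congr 1; ring
    have hcv : c + 1 + m % p ^ (r + 1) = p ^ (r + 1) := by omega
    generalize p ^ (r + 1) = Q at *
    generalize p ^ r = P at *
    generalize m / Q = u at *
    generalize m % Q = v at *
    have h3 : P < (u + 1) * d := by
      by_contra! h
      have h4 : (u + 1) * d * Q ≤ P * Q := Nat.mul_le_mul_right _ h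
      have h5 : (m + 1) * d ≤ Q * (u + 1) * d := Nat.mul_le_mul_right _ (by rw [mul_add]; omega)
      nlinarith
    have h4 : P * Q * (u + 1) ≤ m * (P + 1) := by
      have : P * Q = P * (c + 1) + P * v := by rw [← mul_add, hcv]
      nlinarith
    have h5 : P * Q * ((u + 1) * d) ≤ m * d * (P + 1) := by nlinarith
    nlinarith
  · set a := (C.card - 1) / p ^ r with ha
    have hle : p ^ r * a ≤ C.card - 1 := Nat.mul_div_le _ _
    have hlt : C.card - 1 < p ^ r * a + p ^ r := by
      have := Nat.lt_mul_div_succ (C.card - 1) hpr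
      rwa [mul_add, mul_one] at this
    refine (Nat.mul_le_mul_right _ ?_).trans (key (l := p ^ r * a) (by omega) fun i hi => ?_)
    · omega
    · rcases Nat.lt_or_ge r i with h | h
      · refine lt_of_le_of_lt ?_
          (complement_add_mod_lt (m := m) (s := r + 1) hp.pos h)
        exact Nat.add_le_add_right ((Nat.mod_le _ _).trans (by omega)) _
      · rw [Nat.mod_eq_zero_of_dvd ((pow_dvd_pow p h).mul_right a), zero_add]
        exact Nat.mod_lt _ (pow_pos hp.pos i)

theorem stmt1 (p : ℕ) (hp : p.Prime) (hodd : Odd p)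
    (r : ℕ) (q : ℕ) (hq : q = p ^ (2 * r + 1))
    (d : ℕ) (hd : 2 ≤ d) (hmod : q % (2 * d) = 1)
    (F : Type*) [Field F] [Fintype F] (hF : Fintype.card F = q) :
    (paleyCliqueNumber F d : ℝ) ≤
      max ((p : ℝ) ^ r)
        ((p : ℝ) ^ r / 2 + Real.sqrt (((q : ℝ) - 1) / d + ((p : ℝ) ^ r / 2 - 1) ^ 2)) := by
  obtain ⟨C, hC, hcard⟩ : paleyCliqueNumber F d ∈
      {n : ℕ | ∃ C : Set F, IsPaleyClique F d C ∧ C.ncard = n} := by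
    refine Nat.sSup_mem ⟨0, ∅, by simp [IsPaleyClique], by simp⟩ ⟨Nat.card F, ?_⟩
    rintro n ⟨C, -, rfl⟩
    exact Set.ncard_le_card C
  lift C to Finset F using C.toFinite
  rw [Set.ncard_coe_finset] at hcard
  rw [← hcard]
  rcases Nat.lt_or_ge (p ^ r) C.card with hr | hr
  · refine le_max_of_le_right ?_
    have hq1 : 1 < q := hq ▸ Nat.one_lt_pow (by omega) hp.one_lt
    have hqm : q = 2 * (q / (2 * d)) * d + 1 := by
      have h := Nat.div_add_mod q (2 * d)
      rw [hmod] at h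
      linarith
    set m := 2 * (q / (2 * d)) with hm
    have hm0 : 0 < m := by
      rcases Nat.eq_zero_or_pos m with h | h
      · rw [h] at hqm; omega
      · exact h
    have hbound := hC.card_bound hp (hF.trans hq) hd (hq ▸ hqm) hm0 hr
    have hone : 1 ≤ C.card := by omega
    have hdiv : ((q : ℝ) - 1) / d = m := by
      have hd0 : (d : ℝ) ≠ 0 := by positivity
      rw [div_eq_iff hd0]
      have : (q : ℝ) = m * d + 1 := by exact_mod_cast hqm
      linarith
    have hreal : ((C.card : ℝ) - (p : ℝ) ^ r + 1) * ((C.card : ℝ) - 1) ≤ m := by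
      have h : (((C.card - p ^ r + 1) * (C.card - 1) : ℕ) : ℝ) ≤ m := by exact_mod_cast hbound
      push_cast [Nat.cast_sub hr.le, Nat.cast_sub hone] at h
      exact h
    rw [hdiv, ← sub_le_iff_le_add']
    refine Real.le_sqrt_of_sq_le ?_
    linarith
  · exact le_max_of_le_left (by exact_mod_cast hr)
end

section
/- Let p be an odd prime, q = p^3, and let d be a divisor of p^2 + p + 1 with d > p. Then ω(GP(q,d)) = p. -/
open Polynomial in
/-- The inverse products of differences of the nodes `A` are weights for which every moment
`∑ a ∈ A, w a * (b - a) ^ j` of order `j < #A - 1` vanishes, and the next one is `1`. -/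
theorem sum_inv_prod_sub_mul_pow {K : Type*} [Field K] [DecidableEq K] {A : Finset K} {n : ℕ}
    (hA : A.card = n + 1) (b : K) {j : ℕ} (hj : j ≤ n) :
    ∑ a ∈ A, (∏ x ∈ A.erase a, (x - a))⁻¹ * (b - a) ^ j = if j = n then 1 else 0 := by
  have h := Lagrange.coeff_eq_sum (s := A) (v := fun a => b - a) (P := (X ^ j : K[X]))
    (fun x _ y _ hxy => sub_right_injective hxy)
    (by rw [degree_X_pow, hA]; exact_mod_cast Nat.lt_succ_of_le hj)
  simp only [hA, Nat.add_sub_cancel, coeff_X_pow, eval_pow, eval_X,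
    sub_sub_sub_cancel_left] at h
  simp only [eq_comm (a := j), h, div_eq_inv_mul]

open Polynomial in
/-- The Stepanov-type bound of Hanson and Petridis: if all differences of distinct elements of a set
of size `n + 1` are `m`-th roots of unity and `(n + m).choose m` does not vanish in the field, then
`(n + 1) * n ≤ m`. -/
theorem card_mul_pred_le_of_sub_pow_eq_one {K : Type*} [Field K] {A : Finset K} {n m : ℕ}
    (hA : A.card = n + 1) (hm : 0 < m)
    (hpow : ∀ a ∈ A, ∀ b ∈ A, a ≠ b → (a - b) ^ m = 1)
    (hchoose : ((n + m).choose m : K) ≠ 0) : (n + 1) * n ≤ m := by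
  classical
  set w : K → K := fun a => (∏ x ∈ A.erase a, (x - a))⁻¹
  have hw (b : K) {j : ℕ} (hj : j ≤ n) :
      ∑ a ∈ A, w a * (b - a) ^ j = if j = n then 1 else 0 :=
    sum_inv_prod_sub_mul_pow hA b hj
  set f : K[X] := ∑ a ∈ A, C (w a) * (X - C a) ^ (n + m) - 1 with hf
  have hcomp (b : K) :
      f.comp (X + C b) = ∑ a ∈ A, C (w a) * (X + C (b - a)) ^ (n + m) - 1 := by
    simp only [hf, sub_comp, Polynomial.sum_comp, mul_comp, C_comp, pow_comp, X_comp, one_comp,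
      C_sub, add_sub_assoc]
  have hcoeff (b : K) (i : ℕ) : (f.comp (X + C b)).coeff i =
      (∑ a ∈ A, w a * (b - a) ^ (n + m - i)) * (n + m).choose i - if i = 0 then 1 else 0 := by
    simp only [hcomp, coeff_sub, finsetSum_coeff, coeff_C_mul, coeff_X_add_C_pow, coeff_one,
      Finset.sum_mul, mul_assoc]
  have hcoeff_zero (i : ℕ) := hcoeff 0 i
  simp only [C_0, add_zero, comp_X] at hcoeff_zero
  have hfm : f.coeff m ≠ 0 := by
    rw [hcoeff_zero, Nat.add_sub_cancel, hw 0 le_rfl]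
    simpa [hm.ne'] using hchoose
  have hf0 : f ≠ 0 := fun h => hfm (by simp [h])
  have hdeg : f.natDegree ≤ m := by
    rw [natDegree_le_iff_coeff_eq_zero]
    intro i hi
    rw [hcoeff_zero, if_neg (by lia)]
    rcases le_or_gt i (n + m) with h | h
    · rw [hw 0 (by lia), if_neg (by lia)]
      simp
    · simp [Nat.choose_eq_zero_of_lt h]
  have hdvd : ∏ b ∈ A, (X - C b) ^ n ∣ f := by
    refine Finset.prod_dvd_of_coprime (fun a _ b _ hab =>
      (pairwise_coprime_X_sub_C Function.injective_id hab).pow) fun b hb => ?_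
    rw [X_sub_C_pow_dvd_iff, X_pow_dvd_iff]
    intro i hi
    have hsum : ∑ a ∈ A, w a * (b - a) ^ (n + m - i) = ∑ a ∈ A, w a * (b - a) ^ (n - i) := by
      refine Finset.sum_congr rfl fun a ha => ?_
      rcases eq_or_ne b a with rfl | hab
      · rw [sub_self, zero_pow (by lia), zero_pow (by lia)]
      · rw [show n + m - i = (n - i) + m by lia, pow_add, hpow b hb a ha hab, mul_one]
    rw [hcoeff, hsum, hw b (Nat.sub_le _ _)]
    rcases eq_or_ne i 0 with rfl | hi0
    · simp
    · rw [if_neg (by lia), if_neg hi0]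
      simp
  have hle := natDegree_le_of_dvd hdvd hf0
  rw [natDegree_prod _ _ fun b _ => pow_ne_zero _ (X_sub_C_ne_zero b)] at hle
  simp only [natDegree_pow, natDegree_X_sub_C, mul_one, Finset.sum_const, smul_eq_mul, hA] at hle
  exact hle.trans hdeg

/-- In a finite field with `d * m + 1` elements, the `m`-th roots of unity are `d`-th powers. -/
theorem exists_eq_pow_of_pow_eq_one {F : Type*} [Field F] [Fintype F] {d m : ℕ} (hm : 0 < m)
    (hF : Fintype.card F = d * m + 1) {x : F} (hx : x ^ m = 1) :
    ∃ z : F, z ≠ 0 ∧ x = z ^ d := by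
  have hx0 : x ≠ 0 := fun h => by simp [h, hm.ne'] at hx
  obtain ⟨g, hg⟩ := IsCyclic.exists_generator (α := Fˣ)
  obtain ⟨i, hi⟩ := mem_powers_iff_mem_zpowers.2 (hg (Units.mk0 x hx0))
  have horder : orderOf g = d * m := by
    rw [orderOf_eq_card_of_forall_mem_zpowers hg, Nat.card_units, Nat.card_eq_fintype_card, hF,
      Nat.add_sub_cancel]
  have hgi : g ^ (i * m) = 1 := by
    rw [pow_mul]
    simp only at hi
    rw [hi]
    ext
    simpa using hx
  obtain ⟨k, rfl⟩ := Nat.dvd_of_mul_dvd_mul_right hm (horder ▸ orderOf_dvd_of_pow_eq_one hgi)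
  refine ⟨(g ^ k : Fˣ), Units.ne_zero _, ?_⟩
  have := congrArg Units.val hi
  simp only [Units.val_mk0] at this
  rw [← this, mul_comm, pow_mul, Units.val_pow_eq_pow_val]

/-- The case of Lucas' theorem in which the lower index is `(p - 1) * k`. -/
theorem cast_choose_add_pred_mul_ne_zero {F : Type*} [Field F] {p k : ℕ} [Fact p.Prime] [CharP F p]
    (hk : 0 < k) (hkp : k < p) : ((p + (p - 1) * k).choose ((p - 1) * k) : F) ≠ 0 := by
  have hp0 : 0 < p := by lia
  obtain ⟨l, rfl⟩ : ∃ l, k = l + 1 := ⟨k - 1, by lia⟩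
  obtain ⟨r, rfl⟩ : ∃ r, p = r + (l + 1) := ⟨p - (l + 1), by lia⟩
  have hm : (r + (l + 1) - 1) * (l + 1) = r + (r + (l + 1)) * l := by
    rw [← add_assoc, Nat.add_sub_cancel]; ring
  have hpm : r + (l + 1) + (r + (l + 1) - 1) * (l + 1) = r + (r + (l + 1)) * (l + 1) := by
    rw [hm]; ring
  have h := Choose.choose_modEq_choose_mod_mul_choose_div_nat (p := r + (l + 1))
    (n := r + (l + 1) + (r + (l + 1) - 1) * (l + 1)) (k := (r + (l + 1) - 1) * (l + 1))
  rw [hpm, hm, Nat.add_mul_mod_self_left, Nat.add_mul_mod_self_left, Nat.add_mul_div_left _ _ hp0,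
    Nat.add_mul_div_left _ _ hp0, Nat.mod_eq_of_lt (by lia), Nat.div_eq_of_lt (by lia), zero_add,
    zero_add, Nat.choose_self, one_mul, Nat.choose_succ_self_right] at h
  rw [hpm, hm, Ne, CharP.cast_eq_zero_iff F (r + (l + 1)), h.dvd_iff dvd_rfl]
  exact Nat.not_dvd_of_pos_of_lt hk hkp

theorem stmt3 (p : ℕ) (hp : p.Prime) (hodd : Odd p)
    (q : ℕ) (hq : q = p ^ 3)
    (d : ℕ) (hdvd : d ∣ p ^ 2 + p + 1) (hdp : p < d)
    (F : Type*) [Field F] [Fintype F] (hF : Fintype.card F = q) :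
    paleyCliqueNumber F d = p := by
  have : Fact p.Prime := ⟨hp⟩
  have : CharP F p := charP_of_card_eq_prime_pow (hF.trans hq)
  obtain ⟨k, hk⟩ := hdvd
  have hk0 : 0 < k := Nat.pos_of_ne_zero fun h => by simp [h] at hk
  have hkp : k < p := by
    by_contra! h
    have hp2 := hp.two_le
    rcases h.eq_or_lt with rfl | h
    · have : p ∣ 1 := (Nat.dvd_add_right (Dvd.intro (p + 1) (by ring : p * (p + 1) = p ^ 2 + p))).1
        (hk ▸ Dvd.intro_left d rfl)
      exact hp.one_lt.ne' (Nat.dvd_one.1 this)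
    · nlinarith [Nat.mul_le_mul hdp h]
  have hcard : Fintype.card F = d * ((p - 1) * k) + 1 := by
    obtain ⟨r, rfl⟩ : ∃ r, p = r + 1 := ⟨p - 1, by have := hp.pos; lia⟩
    rw [hF, hq, Nat.add_sub_cancel, Nat.mul_left_comm, ← hk]
    ring
  have hm0 : 0 < (p - 1) * k := Nat.mul_pos (Nat.sub_pos_of_lt hp.one_lt) hk0
  refine IsGreatest.csSup_eq ⟨⟨Set.range (ZMod.castHom dvd_rfl F), ?_, ?_⟩, ?_⟩
  · rintro _ ⟨x, rfl⟩ _ ⟨y, rfl⟩ hxy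
    refine exists_eq_pow_of_pow_eq_one hm0 hcard ?_
    rw [← map_sub, ← map_pow, pow_mul,
      ZMod.pow_card_sub_one_eq_one (sub_ne_zero.2 fun h => hxy (by rw [h])), one_pow, map_one]
  · rw [← Set.image_univ, Set.ncard_image_of_injective _ (RingHom.injective _), Set.ncard_univ,
      Nat.card_zmod]
  · rintro _ ⟨C, hC, rfl⟩
    by_contra! hlt
    obtain ⟨B, hBC, hB⟩ := Set.exists_subset_card_eq (Nat.succ_le_of_lt hlt)
    lift B to Finset F using B.toFinite
    rw [Set.ncard_coe_finset] at hB
    have hpow : ∀ a ∈ B, ∀ b ∈ B, a ≠ b → (a - b) ^ ((p - 1) * k) = 1 := by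
      intro a ha b hb hab
      obtain ⟨z, hz, h⟩ := hC a (hBC ha) b (hBC hb) hab
      have hcard' : d * ((p - 1) * k) = Fintype.card F - 1 := by lia
      rw [h, ← pow_mul, hcard', FiniteField.pow_card_sub_one_eq_one z hz]
    have hle := card_mul_pred_le_of_sub_pow_eq_one hB hm0 hpow
      (cast_choose_add_pred_mul_ne_zero hk0 hkp)
    have := Nat.mul_le_mul (Nat.sub_le p 1) hkp.le
    nlinarith [hp.pos]
end

section
/- Let p be an odd prime and let A, B ⊆ F_p be sets each of size at least two such that |A|·|B| < p. Then the set of directions determined by the Cartesian product A × B in AG(2,p) has size at least |A|·|B| - min{|A|, |B|} + 2. -/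
/-- The set of directions determined by a point set `U ⊆ AG(2,F)`, as a subset of
`Option F`, where `none` represents the vertical direction `∞` and `some m` the slope `m`. -/
def directionSet (F : Type*) [Field F] (U : Set (F × F)) : Set (Option F) :=
  {x | ∃ P ∈ U, ∃ Q ∈ U, P ≠ Q ∧
    ((P.1 = Q.1 ∧ x = none) ∨ (P.1 ≠ Q.1 ∧ x = some ((Q.2 - P.2) / (Q.1 - P.1))))}

open Polynomial

/-- The bivariate polynomial `P ∈ R[Y][X]` has total degree at most `d`. -/
def BivariateDegreeLE {R : Type*} [CommRing R] (d : ℕ) (P : R[X][X]) : Prop :=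
  ∀ k j, d < k + j → (P.coeff k).coeff j = 0

namespace BivariateDegreeLE

variable {R : Type*} [CommRing R] {d e : ℕ} {P Q : R[X][X]}

lemma sub (hP : BivariateDegreeLE d P) (hQ : BivariateDegreeLE d Q) :
    BivariateDegreeLE d (P - Q) := by
  intro k j h
  simp [hP k j h, hQ k j h]

lemma mul (hP : BivariateDegreeLE d P) (hQ : BivariateDegreeLE e Q) :
    BivariateDegreeLE (d + e) (P * Q) := by
  intro k j h
  rw [coeff_mul, finsetSum_coeff]
  refine Finset.sum_eq_zero fun x hx => ?_
  rw [coeff_mul]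
  refine Finset.sum_eq_zero fun y hy => ?_
  rw [Finset.HasAntidiagonal.mem_antidiagonal] at hx hy
  rcases lt_or_ge d (x.1 + y.1) with h' | h'
  · simp [hP _ _ h']
  · simp [hQ x.2 y.2 (by omega)]

lemma one : BivariateDegreeLE 0 (1 : R[X][X]) := by
  intro k j h
  rcases Nat.eq_zero_or_pos k with rfl | hk
  · simp [coeff_one, show j ≠ 0 by omega]
  · simp [coeff_one, hk.ne']

lemma X_pow (d : ℕ) : BivariateDegreeLE d (X ^ d : R[X][X]) := by
  intro k j h
  rw [coeff_X_pow]
  split_ifs with hk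
  · simp [coeff_one, show j ≠ 0 by omega]
  · simp

lemma X_sub_C (a b : R) :
    BivariateDegreeLE 1 (X - C (C b - C a * X) : R[X][X]) := by
  intro k j h
  rcases Nat.eq_zero_or_pos k with rfl | hk
  · simp [coeff_C, coeff_X, show j ≠ 0 by omega, show 1 ≠ j by omega]
  · rw [coeff_sub, coeff_C_of_ne_zero hk.ne', coeff_X]
    split_ifs with hk1
    · simp [coeff_one, show j ≠ 0 by omega]
    · simp

lemma prod {ι : Type*} (s : Finset ι) (f : ι → R[X][X])
    (hf : ∀ i ∈ s, BivariateDegreeLE 1 (f i)) : BivariateDegreeLE s.card (∏ i ∈ s, f i) := by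
  classical
  induction s using Finset.induction_on with
  | empty => simpa using one
  | insert i s hi ih =>
    rw [Finset.prod_insert hi, Finset.card_insert_of_notMem hi, add_comm]
    exact (hf i (by simp)).mul (ih fun j hj => hf j (by simp [hj]))

lemma natDegree_coeff_le (hP : BivariateDegreeLE d P) (k : ℕ) :
    (P.coeff k).natDegree ≤ d - k :=
  natDegree_le_iff_coeff_eq_zero.mpr fun _ hj => hP _ _ (by omega)

/-- Dividing `X ^ d` by a monic polynomial `H` of matching total degree leaves a remainder of
total degree at most `d`. -/
lemma exists_remainder_X_pow {H : R[X][X]} {n : ℕ} (hn : 0 < n) (hmonic : H.coeff n = 1)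
    (hH : BivariateDegreeLE n H) (d : ℕ) :
    ∃ r : R[X][X], H ∣ X ^ d - r ∧ (∀ k, n ≤ k → r.coeff k = 0) ∧ BivariateDegreeLE d r := by
  have hHcoeff : ∀ k, n < k → H.coeff k = 0 := fun k hk => by
    ext j
    simpa using hH k j (by omega)
  induction d with
  | zero =>
    refine ⟨1, by simp, fun k hk => ?_, one⟩
    simp [coeff_one, show k ≠ 0 by omega]
  | succ d ih =>
    obtain ⟨r, hdvd, hlow, hr⟩ := ih
    have hX : BivariateDegreeLE (d + 1) (X * r) := by
      rw [add_comm]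
      simpa using (X_pow 1).mul hr
    have hC : BivariateDegreeLE (d + 1) (C (r.coeff (n - 1)) * H) := by
      rcases lt_or_ge (d + 1) n with hdn | hdn
      · have : r.coeff (n - 1) = 0 := by
          ext j
          simpa using hr (n - 1) j (by omega)
        intro k j _
        simp [this]
      · have hc : BivariateDegreeLE (d + 1 - n) (C (r.coeff (n - 1))) := by
          intro k j h
          rcases Nat.eq_zero_or_pos k with rfl | hk
          · simpa using hr (n - 1) j (by omega)
          · simp [coeff_C_of_ne_zero hk.ne']
        simpa [Nat.sub_add_cancel hdn] using hc.mul hH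
    refine ⟨X * r - C (r.coeff (n - 1)) * H, ?_, fun k hk => ?_, hX.sub hC⟩
    · have : X ^ (d + 1) - (X * r - C (r.coeff (n - 1)) * H) =
          X * (X ^ d - r) + C (r.coeff (n - 1)) * H := by ring
      rw [this]
      exact dvd_add (hdvd.mul_left _) (dvd_mul_left _ _)
    · obtain ⟨k, rfl⟩ : ∃ l, k = l + 1 := ⟨k - 1, by omega⟩
      rw [coeff_sub, coeff_X_mul, coeff_C_mul]
      rcases hk.eq_or_lt with h | h
      · rw [← h, hmonic, show n - 1 = k by omega]
        simp
      · rw [hlow k (by omega), hHcoeff _ h]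
        simp

end BivariateDegreeLE

lemma prod_X_sub_C_dvd_X_pow_card_sub_X {F ι : Type*} [Field F] [Fintype F] (s : Finset ι)
    (f : ι → F) (hf : Set.InjOn f s) :
    ∏ i ∈ s, (X - C (f i)) ∣ (X ^ Fintype.card F - X : F[X]) := by
  refine Finset.prod_dvd_of_coprime (fun i hi j hj hij => ?_) fun i _ => ?_
  · exact isCoprime_X_sub_C_of_isUnit_sub
      (sub_ne_zero.mpr fun h => hij (hf hi hj h)).isUnit
  · rw [dvd_iff_isRoot]
    simp [FiniteField.pow_card]

/-- The Rédei polynomial of a point set. -/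
noncomputable def redeiPolynomial {F : Type*} [Field F] (U : Finset (F × F)) : F[X][X] :=
  ∏ P ∈ U, (X - C (C P.2 - C P.1 * X))

section Redei

variable {F : Type*} [Field F] (U : Finset (F × F))

lemma map_redeiPolynomial (m : F) :
    (redeiPolynomial U).map (evalRingHom m) = ∏ P ∈ U, (X - C (P.2 - P.1 * m)) := by
  simp [redeiPolynomial, Polynomial.map_prod]

lemma coeff_card_redeiPolynomial : (redeiPolynomial U).coeff U.card = 1 := by
  have hdeg : (redeiPolynomial U).natDegree = U.card := by
    rw [redeiPolynomial, natDegree_prod_of_monic _ _ fun P _ => monic_X_sub_C (C P.2 - C P.1 * X)]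
    simp only [natDegree_X_sub_C, Finset.sum_const, smul_eq_mul, mul_one]
  rw [← hdeg]
  exact monic_prod_of_monic _ _ fun P _ => monic_X_sub_C _

lemma bivariateDegreeLE_redeiPolynomial : BivariateDegreeLE U.card (redeiPolynomial U) :=
  .prod _ _ fun _ _ => .X_sub_C _ _

lemma injOn_of_notMem_directionSet {m : F} (hm : some m ∉ directionSet F (U : Set (F × F))) :
    Set.InjOn (fun P : F × F => P.2 - P.1 * m) U := by
  intro P hP Q hQ hPQ
  by_contra hne
  have hPQ' : P.2 - P.1 * m = Q.2 - Q.1 * m := hPQ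
  have h1 : P.1 ≠ Q.1 := fun h => hne (Prod.ext h (by rw [h] at hPQ'; simpa using hPQ'))
  refine hm ⟨P, hP, Q, hQ, hne, Or.inr ⟨h1, congrArg some ?_⟩⟩
  rw [eq_div_iff (sub_ne_zero.mpr h1.symm)]
  linear_combination hPQ'

/-- The Rédei polynomial of `U`, specialised at the slope `0`, divides a polynomial `X ^ q - g`
with `g` of degree at most the number of slopes determined by `U`. -/
lemma exists_lacunary [Fintype F] (hU : 2 ≤ U.card) (hUF : U.card ≤ Fintype.card F)
    (hpos : 0 < {m : F | some m ∈ directionSet F (U : Set (F × F))}.ncard) :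
    ∃ g : F[X], ∏ P ∈ U, (X - C P.2) ∣ X ^ Fintype.card F - g ∧ g.natDegree < U.card ∧
      g.natDegree ≤ {m : F | some m ∈ directionSet F (U : Set (F × F))}.ncard := by
  classical
  set S : Set F := {m : F | some m ∈ directionSet F (U : Set (F × F))} with hS
  obtain ⟨r, hdvd, hlow, hr⟩ := BivariateDegreeLE.exists_remainder_X_pow
    (by omega) (coeff_card_redeiPolynomial U) (bivariateDegreeLE_redeiPolynomial U)
    (Fintype.card F)
  have hdvd' (m : F) : ∏ P ∈ U, (X - C (P.2 - P.1 * m)) ∣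
      X ^ Fintype.card F - r.map (evalRingHom m) := by
    simpa [map_redeiPolynomial] using (mapRingHom (evalRingHom m)).map_dvd hdvd
  have hspec (m : F) (hm : m ∉ S) : r.map (evalRingHom m) = X := by
    have h := dvd_sub (prod_X_sub_C_dvd_X_pow_card_sub_X U _ (injOn_of_notMem_directionSet U hm))
      (hdvd' m)
    rw [sub_sub_sub_cancel_left] at h
    refine sub_eq_zero.mp (eq_zero_of_dvd_of_degree_lt h ?_)
    have hdeg : (∏ P ∈ U, (X - C (P.2 - P.1 * m)) : F[X]).degree = U.card := by
      simp only [degree_prod, degree_X_sub_C, Finset.sum_const, nsmul_one]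
    rw [hdeg]
    refine (degree_lt_iff_coeff_zero _ _).mpr fun k hk => ?_
    simp [hlow k hk, coeff_X, show 1 ≠ k by omega]
  have hzero (k : ℕ) (hk : S.ncard < k) : r.coeff k = 0 := by
    by_cases hkU : U.card ≤ k
    · exact hlow k hkU
    refine eq_zero_of_natDegree_lt_card_of_eval_eq_zero' _ Sᶜ.toFinset (fun m hm => ?_) ?_
    · have := congrArg (coeff · k) (hspec m (by simpa using hm))
      simpa [coeff_X, show 1 ≠ k by omega] using this
    · have h1 := hr.natDegree_coeff_le k
      have h2 := Set.ncard_add_ncard_compl S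
      rw [Nat.card_eq_fintype_card] at h2
      rw [← Set.ncard_eq_toFinset_card']
      omega
  refine ⟨r.map (evalRingHom 0), by simpa using hdvd' 0, ?_, ?_⟩
  · refine Nat.lt_of_le_pred (by omega) (natDegree_le_iff_coeff_eq_zero.mpr fun k hk => ?_)
    simp [hlow k (Nat.le_of_pred_lt hk)]
  · exact natDegree_le_iff_coeff_eq_zero.mpr fun k hk => by simp [hzero k hk]

end Redei

lemma ncard_directionSet_swap_le {F : Type*} [Field F] [Finite F] (A B : Finset F) :
    (directionSet F {P : F × F | P.1 ∈ B ∧ P.2 ∈ A}).ncard ≤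
      (directionSet F {P : F × F | P.1 ∈ A ∧ P.2 ∈ B}).ncard := by
  classical
  let e : Option F → Option F := fun x => x.elim (some 0) fun m => if m = 0 then none else some m⁻¹
  refine le_trans (Set.ncard_le_ncard ?_ (Set.toFinite _)) (Set.ncard_image_le (f := e)
    (Set.toFinite _))
  rintro x ⟨P, hP, Q, hQ, hne, h⟩
  have hne' : P.swap ≠ Q.swap := fun h => hne (Prod.swap_injective h)
  rcases h with ⟨h1, rfl⟩ | ⟨h1, rfl⟩
  · have h2 : P.2 ≠ Q.2 := fun h2 => hne (Prod.ext h1 h2)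
    exact ⟨some 0, ⟨P.swap, hP.symm, Q.swap, hQ.symm, hne', Or.inr ⟨h2, by simp [h1]⟩⟩, by simp [e]⟩
  · by_cases h2 : P.2 = Q.2
    · exact ⟨none, ⟨P.swap, hP.symm, Q.swap, hQ.symm, hne', Or.inl ⟨h2, rfl⟩⟩, by simp [e, h2]⟩
    · refine ⟨_, ⟨P.swap, hP.symm, Q.swap, hQ.symm, hne', Or.inr ⟨h2, rfl⟩⟩, ?_⟩
      have : (Q.1 - P.1) / (Q.2 - P.2) ≠ 0 :=
        div_ne_zero (sub_ne_zero.mpr (Ne.symm h1)) (sub_ne_zero.mpr (Ne.symm h2))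
      simp only [e, Option.elim_some, Prod.fst_swap, Prod.snd_swap, if_neg this, inv_div]

lemma card_mul_sub_add_two_le_ncard_directionSet {p : ℕ} (hp : p.Prime)
    {F : Type*} [Field F] [Fintype F] (hF : Fintype.card F = p)
    (A B : Finset F) (hA : 2 ≤ A.card) (hB : 2 ≤ B.card) (hAB : A.card * B.card < p) :
    A.card * B.card - B.card + 2 ≤
      (directionSet F {P : F × F | P.1 ∈ A ∧ P.2 ∈ B}).ncard := by
  have : Fact p.Prime := ⟨hp⟩
  have : CharP F p := charP_of_card_eq_prime hF
  have hcoe : {P : F × F | P.1 ∈ A ∧ P.2 ∈ B} = ((A ×ˢ B : Finset (F × F)) : Set (F × F)) := by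
    ext; simp
  rw [hcoe]
  set D := directionSet F ((A ×ˢ B : Finset (F × F)) : Set (F × F)) with hD
  set S : Set F := {m : F | some m ∈ D} with hS
  obtain ⟨a₁, ha₁, a₂, ha₂, ha⟩ := Finset.one_lt_card.mp hA
  obtain ⟨b₁, hb₁, b₂, hb₂, hb⟩ := Finset.one_lt_card.mp hB
  have hnone : none ∈ D := ⟨(a₁, b₁), by simp [*], (a₁, b₂), by simp [*], by simp [hb], by simp⟩
  have h0 : (0 : F) ∈ S :=
    ⟨(a₁, b₁), by simp [*], (a₂, b₁), by simp [*], by simp [ha], by simp [ha]⟩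
  have hDcard : D.ncard = S.ncard + 1 := by
    have : D = insert none (some '' S) := by
      ext x
      cases x <;> simp [hnone, hS]
    rw [this, Set.ncard_insert_of_notMem (by simp) (Set.toFinite _),
      Set.ncard_image_of_injective _ (Option.some_injective F)]
  have hcard : (A ×ˢ B).card = A.card * B.card := Finset.card_product A B
  obtain ⟨g, hdvd, hdeg, hdegS⟩ := exists_lacunary (A ×ˢ B) (by nlinarith) (by omega)
    ((Set.ncard_pos (Set.toFinite S)).mpr ⟨0, h0⟩)
  replace hdegS : g.natDegree ≤ S.ncard := hdegS
  rw [hF] at hdvd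
  have hprod : ∏ P ∈ A ×ˢ B, (X - C P.2 : F[X]) = ∏ b ∈ B, (X - C b) ^ A.card := by
    rw [Finset.prod_product_right]
    simp
  rw [hprod] at hdvd
  have hpow (b : F) (hbB : b ∈ B) : (X - C b) ^ A.card ∣ X ^ p - g :=
    (Finset.dvd_prod_of_mem (fun b => (X - C b) ^ A.card) hbB).trans hdvd
  have hder : ∏ b ∈ B, (X - C b) ^ (A.card - 1) ∣ derivative g := by
    refine Finset.prod_dvd_of_coprime (fun b _ c _ hbc => ?_) fun b hbB => ?_
    · exact (isCoprime_X_sub_C_of_isUnit_sub (sub_ne_zero.mpr hbc).isUnit).pow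
    · simpa [derivative_X_pow] using pow_sub_one_dvd_derivative_of_pow_dvd (hpow b hbB)
  have hne : derivative g ≠ 0 := by
    intro hg
    have hconst : g = C (g.coeff 0) := by
      refine eq_C_of_natDegree_eq_zero (Nat.le_zero.mp
        (natDegree_le_iff_coeff_eq_zero.mpr fun k hk => ?_))
      by_cases hkp : p ≤ k
      · exact coeff_eq_zero_of_natDegree_lt (by omega)
      obtain ⟨k, rfl⟩ : ∃ l, k = l + 1 := ⟨k - 1, by omega⟩
      have h := congrArg (coeff · k) hg
      simp only [coeff_derivative, coeff_zero] at h
      refine (mul_eq_zero.mp h).resolve_right ?_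
      have := (CharP.cast_eq_zero_iff F p (k + 1)).not.mpr
        (Nat.not_dvd_of_pos_of_lt (by omega) (by omega))
      simpa using this
    have hroot (b : F) (hbB : b ∈ B) : b = g.coeff 0 := by
      have h : IsRoot (X ^ p - g) b :=
        dvd_iff_isRoot.mp ((dvd_pow_self _ (by omega)).trans (hpow b hbB))
      rw [hconst] at h
      have hbp : b ^ p = b := hF ▸ FiniteField.pow_card b
      simpa [hbp, sub_eq_zero] using h
    exact hb ((hroot _ hb₁).trans (hroot _ hb₂).symm)
  have hle := natDegree_le_of_dvd hder hne
  have hgpos : g.natDegree ≠ 0 := fun h => hne (derivative_of_natDegree_zero h)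
  have hlt := natDegree_derivative_lt hgpos
  have hprodDeg : (∏ b ∈ B, (X - C b) ^ (A.card - 1) : F[X]).natDegree =
      A.card * B.card - B.card := by
    rw [natDegree_prod_of_monic _ _ fun b _ => (monic_X_sub_C b).pow _]
    simp [Nat.mul_sub, mul_comm]
  omega

theorem stmt4 (p : ℕ) (hp : p.Prime) (hodd : Odd p)
    (F : Type*) [Field F] [Fintype F] (hF : Fintype.card F = p)
    (A B : Finset F) (hA : 2 ≤ A.card) (hB : 2 ≤ B.card)
    (hAB : A.card * B.card < p) :
    A.card * B.card - min A.card B.card + 2 ≤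
      (directionSet F {P : F × F | P.1 ∈ A ∧ P.2 ∈ B}).ncard := by
  rcases le_total A.card B.card with h | h
  · rw [min_eq_left h, mul_comm]
    exact (card_mul_sub_add_two_le_ncard_directionSet hp hF B A hB hA (by rwa [mul_comm])).trans
      (ncard_directionSet_swap_le A B)
  · rw [min_eq_right h]
    exact card_mul_sub_add_two_le_ncard_directionSet hp hF A B hA hB hAB
end

section
/- Let p be an odd prime and q a power of p. If A ⊆ F_q satisfies |A| > q/p, then the difference set A - A = {a - a' : a, a' ∈ A} has size at least min{ 2|A| - q/p , q }. -/
open scoped Pointwise in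
/-- In a finite abelian group all of whose proper subgroups have at most `m` elements, a sumset
`A + B` is either everything or has at least `|A| + |B| - m` elements. -/
theorem Finset.add_eq_univ_or_card_add_card_le_card_add {G : Type*} [AddCommGroup G] [Fintype G]
    [DecidableEq G] (m : ℕ) (hm : ∀ H : AddSubgroup G, H ≠ ⊤ → Nat.card H ≤ m)
    (A B : Finset G) (hA : A.Nonempty) (hB : B.Nonempty) :
    A + B = Finset.univ ∨ A.card + B.card ≤ (A + B).card + m := by
  induction hn : B.card using Nat.strong_induction_on generalizing A B with
  | _ n ih =>
  subst hn
  by_cases hstable : ∀ a ∈ A, ∀ b ∈ B, ∀ c ∈ B, a - b + c ∈ A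
  · set H : AddSubgroup G :=
      AddAction.stabilizer G (A : Set G) with hH
    have hsub : ∀ b ∈ B, ∀ c ∈ B, c - b ∈ H := by
      intro b hb c hc
      rw [hH, AddAction.mem_stabilizer_set_iff_vadd_set_subset A.finite_toSet]
      rintro _ ⟨a, ha, rfl⟩
      have := hstable a ha b hb c hc
      simpa [vadd_eq_add, sub_add_eq_add_sub, add_comm, add_sub_assoc, sub_eq_add_neg,
        add_left_comm] using this
    by_cases htop : H = ⊤
    · left
      obtain ⟨a, ha⟩ := hA
      obtain ⟨b, hb⟩ := hB
      refine Finset.eq_univ_of_forall fun x => ?_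
      have hx : x - b - a ∈ H := htop ▸ AddSubgroup.mem_top _
      rw [hH, AddAction.mem_stabilizer_iff] at hx
      have : (x - b - a) +ᵥ a ∈ (x - b - a) +ᵥ (A : Set G) := Set.vadd_mem_vadd_set ha
      rw [hx, vadd_eq_add, sub_add_cancel] at this
      exact Finset.mem_add.2 ⟨x - b, this, b, hb, sub_add_cancel _ _⟩
    · right
      have hBm : B.card ≤ m := by
        refine le_trans ?_ (hm H htop)
        obtain ⟨b, hb⟩ := hB
        rw [← Nat.card_eq_finsetCard]
        exact Nat.card_le_card_of_injective (fun c : B => (⟨c - b, hsub b hb c c.2⟩ : H))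
          fun c d h => Subtype.ext (sub_left_injective (congrArg Subtype.val h))
      have := Finset.card_le_card_add_right (s := A) hB
      omega
  · push Not at hstable
    obtain ⟨a, ha, b, hb, c, hc, habc⟩ := hstable
    set A' := (Finset.addDysonETransform (a - b) (A, B)).1
    set B' := (Finset.addDysonETransform (a - b) (A, B)).2
    have hbB' : b ∈ B' := by
      refine Finset.mem_inter.2 ⟨hb, Finset.mem_vadd_finset.2 ⟨a, ha, ?_⟩⟩
      rw [vadd_eq_add, neg_sub, sub_add_cancel]
    have hlt : B'.card < B.card := by
      refine Finset.card_lt_card (Finset.ssubset_iff_of_subset Finset.inter_subset_left |>.2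
        ⟨c, hc, fun hcB' => habc ?_⟩)
      simp only [Finset.mem_inter, Finset.mem_vadd_finset, vadd_eq_add] at hcB'
      obtain ⟨-, y, hy, rfl⟩ := hcB'
      rwa [← add_assoc, add_neg_cancel, zero_add]
    have hsub : A' + B' ⊆ A + B := Finset.addDysonETransform.subset (a - b) (A, B)
    have hcard : A'.card + B'.card = A.card + B.card :=
      Finset.addDysonETransform.card (a - b) (A, B)
    have hA'ne : A'.Nonempty := hA.mono Finset.subset_union_left
    rcases ih _ hlt A' B' hA'ne ⟨b, hbB'⟩ rfl with h | h
    · exact Or.inl (Finset.univ_subset_iff.1 (h ▸ hsub))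
    · have := Finset.card_le_card hsub
      right
      omega

theorem AddSubgroup.card_le_of_ne_top_of_card_eq_prime_pow {G : Type*} [AddGroup G] {p k : ℕ}
    (hp : p.Prime) (hG : Nat.card G = p ^ (k + 1)) (H : AddSubgroup G) (hH : H ≠ ⊤) :
    Nat.card H ≤ p ^ k := by
  have : Finite G := Nat.finite_of_card_ne_zero (hG ▸ pow_ne_zero _ hp.ne_zero)
  obtain ⟨j, hj, hcard⟩ := (Nat.dvd_prime_pow hp).1 (hG ▸ H.card_addSubgroup_dvd_card)
  rw [hcard]
  refine Nat.pow_le_pow_right hp.pos (Nat.le_of_lt_succ (lt_of_le_of_ne hj ?_))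
  rintro rfl
  exact hH (AddSubgroup.eq_top_of_card_eq H (hcard.trans hG.symm))

open scoped Pointwise in
theorem stmt8 (p : ℕ) (hp : p.Prime) (hodd : Odd p)
    (q : ℕ) (hq : ∃ k : ℕ, 0 < k ∧ q = p ^ k)
    (F : Type*) [Field F] [Fintype F] (hF : Fintype.card F = q)
    (A : Finset F) (hA : q / p < A.card) :
    min (2 * A.card - q / p) q ≤ {x : F | ∃ a ∈ A, ∃ b ∈ A, x = a - b}.ncard := by
  classical
  obtain ⟨k, hk, rfl⟩ := hq
  obtain ⟨k, rfl⟩ := Nat.exists_eq_succ_of_ne_zero hk.ne'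
  have hdiv : p ^ (k + 1) / p = p ^ k := by rw [pow_succ, Nat.mul_div_cancel _ hp.pos]
  have hne : A.Nonempty := Finset.card_pos.1 (Nat.zero_lt_of_lt hA)
  have hset : {x : F | ∃ a ∈ A, ∃ b ∈ A, x = a - b} = ((A + -A : Finset F) : Set F) := by
    ext x
    simp only [← sub_eq_add_neg, Finset.coe_sub, Set.mem_sub, Set.mem_ofPred_eq, Finset.mem_coe,
      eq_comm]
  rw [hset, Set.ncard_coe_finset]
  rcases Finset.add_eq_univ_or_card_add_card_le_card_add (p ^ k)
    (AddSubgroup.card_le_of_ne_top_of_card_eq_prime_pow hp (by rw [Nat.card_eq_fintype_card, hF]))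
    A (-A) hne hne.neg with h | h
  · rw [h, Finset.card_univ, hF]
    exact min_le_right _ _
  · rw [Finset.card_neg] at h
    exact (min_le_left _ _).trans (by simp only [Nat.succ_eq_add_one, hdiv]; omega)
end

section
/- Let p be an odd prime, q a power of p, and K a proper subfield of F_q. If A ⊆ F_q satisfies |A| = q/|K| + 1, then the set (A - A)·K = { (a - a')·k : a, a' ∈ A, k ∈ K } has size strictly greater than |A| · ( |K| - |K|/p - 1 ). -/
/-- A set with more than `|F| / |K|` elements meets some line in every direction over `K` twice. -/
theorem exists_eq_sub_mul_of_card_lt {F : Type*} [Field F] [Fintype F] (K : Subfield F)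
    (A : Finset F) (h : Fintype.card F < A.card * Nat.card K) (x : F) :
    ∃ a ∈ A, ∃ b ∈ A, ∃ k ∈ K, x = (a - b) * k := by
  have hninj : ¬ Function.Injective (fun y : A × K => (y.1 : F) + (y.2 : F) * x) := by
    intro hinj
    have := Nat.card_le_card_of_injective _ hinj
    simp only [Nat.card_prod, Nat.card_eq_fintype_card (α := F),
      Nat.card_eq_fintype_card (α := A), Fintype.card_coe] at this
    omega
  simp only [Function.Injective, not_forall] at hninj
  obtain ⟨⟨⟨a, ha⟩, k⟩, ⟨⟨b, hb⟩, l⟩, heq, hne⟩ := hninj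
  simp only at heq
  have hkl : (l : F) - k ≠ 0 := by
    intro hlk
    have h1 : (l : F) = k := sub_eq_zero.mp hlk
    rw [h1] at heq
    exact hne (Prod.ext (Subtype.ext (add_right_cancel heq)) (Subtype.ext h1.symm))
  refine ⟨a, ha, b, hb, ((l : F) - k)⁻¹, K.inv_mem (K.sub_mem l.2 k.2), ?_⟩
  rw [eq_mul_inv_iff_mul_eq₀ hkl]
  linear_combination -heq

theorem Subfield.card_mul_card_le_of_ne_top {F : Type*} [Field F] [Fintype F] (K : Subfield F)
    (hK : K ≠ ⊤) : Nat.card K * Nat.card K ≤ Fintype.card F := by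
  obtain ⟨v, hv⟩ : ∃ v, v ∉ K := by
    by_contra! h
    exact hK (eq_top_iff.mpr fun x _ => h x)
  have hinj : Function.Injective (fun y : K × K => (y.1 : F) + (y.2 : F) * v) := by
    rintro ⟨a, k⟩ ⟨b, l⟩ heq
    simp only at heq
    have hkl : (l : F) = k := by
      by_contra hne
      have hlk : (l : F) - k ≠ 0 := sub_ne_zero.mpr hne
      apply hv
      have : v = ((a : F) - b) * ((l : F) - k)⁻¹ := by
        rw [eq_mul_inv_iff_mul_eq₀ hlk]
        linear_combination -heq
      rw [this]
      exact K.mul_mem (K.sub_mem a.2 b.2) (K.inv_mem (K.sub_mem l.2 k.2))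
    rw [hkl] at heq
    exact Prod.ext (Subtype.ext (add_right_cancel heq)) (Subtype.ext hkl.symm)
  simpa [Nat.card_prod, Nat.card_eq_fintype_card (α := F)] using
    Nat.card_le_card_of_injective _ hinj

theorem stmt9 (p : ℕ) (hp : p.Prime) (hodd : Odd p)
    (q : ℕ) (hq : ∃ k : ℕ, 0 < k ∧ q = p ^ k)
    (F : Type*) [Field F] [Fintype F] (hF : Fintype.card F = q)
    (K : Subfield F) (hK : K ≠ ⊤)
    (A : Finset F) (hA : A.card = q / Nat.card K + 1) :
    A.card * (Nat.card K - Nat.card K / p - 1) <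
      {x : F | ∃ a ∈ A, ∃ b ∈ A, ∃ k ∈ K, x = (a - b) * k}.ncard := by
  have hs : 0 < Nat.card K := Nat.card_pos
  have hsq := K.card_mul_card_le_of_ne_top hK
  rw [hF] at hsq
  have hlt : Fintype.card F < A.card * Nat.card K := by
    rw [hF, hA, add_mul, one_mul]
    exact Nat.lt_div_mul_add hs
  have huniv : {x : F | ∃ a ∈ A, ∃ b ∈ A, ∃ k ∈ K, x = (a - b) * k} = Set.univ :=
    Set.eq_univ_of_forall (exists_eq_sub_mul_of_card_lt K A hlt)
  rw [huniv, Set.ncard_univ, Nat.card_eq_fintype_card (α := F), hF, hA]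
  have hm : Nat.card K ≤ q / Nat.card K := (Nat.le_div_iff_mul_le hs).mpr hsq
  have hmq : q / Nat.card K * Nat.card K ≤ q := Nat.div_mul_le_self _ _
  calc (q / Nat.card K + 1) * (Nat.card K - Nat.card K / p - 1)
      ≤ (q / Nat.card K + 1) * (Nat.card K - 1) := by gcongr; exact Nat.sub_le _ _
    _ < q / Nat.card K * Nat.card K := by
      obtain ⟨t, ht⟩ := Nat.exists_eq_add_of_lt hs
      generalize q / Nat.card K = m at *
      rw [ht] at hm ⊢
      simp only [zero_add, Nat.add_sub_cancel] at hm ⊢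
      nlinarith
    _ ≤ q := hmq
end

section
/- Let p be a prime with p ≡ 1 (mod 3), let m be a positive integer, let q = p^{3m}, and let d = (p^{2m} + p^m + 1)/3 (an integer since p ≡ 1 (mod 3)). Then ω(GP(q,d)) = p^m. -/
/-- Nonzero eigenvectors of a field endomorphism, with eigenvalues in its fixed field, have the same
eigenvalue if their difference is again an eigenvector. -/
theorem eigenvalue_eq_of_sub {F : Type*} [Field F] (φ : F →+* F) {a b ζ η θ : F}
    (hb0 : b ≠ 0) (ha0 : a ≠ 0) (ha : φ a = ζ * a) (hb : φ b = η * b)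
    (hc : φ (a - b) = θ * (a - b)) (hζ : φ ζ = ζ) (hη : φ η = η) (hθ : φ θ = θ) : ζ = η := by
  by_contra hne
  have h1 : (ζ - θ) * a = (η - θ) * b := by
    rw [map_sub, ha, hb] at hc
    linear_combination hc
  have h2 : (ζ - θ) * (ζ * a) = (η - θ) * (η * b) := by
    simpa [ha, hb, hζ, hη, hθ] using congrArg φ h1
  have h3 : (η - θ) * ((η - ζ) * b) = 0 := by linear_combination ζ * h1 - h2
  have h4 : η = θ := by
    simpa [sub_eq_zero, hb0, Ne.symm hne] using h3
  rw [h4, sub_self, zero_mul] at h1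
  have h5 : ζ = θ := by simpa [sub_eq_zero, ha0] using h1
  exact hne (h5.trans h4.symm)

theorem ncard_setOf_pow_eq_mul_le {F : Type*} [Field F] {n : ℕ} (hn : 1 < n) (ζ : F) :
    {a : F | a ^ n = ζ * a}.ncard ≤ n := by
  classical
  open Polynomial in
  have hdeg : (X ^ n - C ζ * X : F[X]).natDegree = n := by
    have : (C ζ * X : F[X]).natDegree < (X ^ n : F[X]).natDegree := by
      rw [natDegree_X_pow]
      exact (natDegree_C_mul_le _ _).trans_lt (natDegree_X_le.trans_lt hn)
    rw [natDegree_sub_eq_left_of_natDegree_lt this, natDegree_X_pow]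
  open Polynomial in
  have hne : (X ^ n - C ζ * X : F[X]) ≠ 0 := by
    intro h
    rw [h, natDegree_zero] at hdeg
    omega
  open Polynomial in
  calc {a : F | a ^ n = ζ * a}.ncard
      ≤ ((X ^ n - C ζ * X : F[X]).roots.toFinset : Set F).ncard := by
        refine Set.ncard_le_ncard (fun a ha => ?_) (Finset.finite_toSet _)
        have ha' : a ^ n = ζ * a := ha
        simp [hne, ha']
    _ ≤ n := by
        rw [Set.ncard_coe_finset, ← hdeg]
        exact (Multiset.toFinset_card_le _).trans (by rw [hdeg]; exact (card_roots' _).trans hdeg.le)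

theorem exists_pow_eq_of_pow_eq_one {F : Type*} [Field F] [Fintype F] {d k : ℕ} (hk : k ≠ 0)
    (hdk : d * k ∣ Fintype.card F - 1) {a : F} (ha0 : a ≠ 0) (ha : a ^ k = 1) :
    ∃ z : F, z ≠ 0 ∧ a = z ^ d := by
  classical
  obtain ⟨g, hg⟩ := IsCyclic.exists_generator (α := Fˣ)
  obtain ⟨j, hj⟩ := mem_powers_iff_mem_zpowers.mpr (hg (Units.mk0 a ha0))
  have hord : orderOf g = Fintype.card F - 1 := by
    rw [orderOf_eq_card_of_forall_mem_zpowers hg, Nat.card_eq_fintype_card, Fintype.card_units]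
  have h1 : g ^ (j * k) = 1 := by
    have hj' : g ^ j = Units.mk0 a ha0 := hj
    rw [pow_mul, hj']
    ext
    simpa using ha
  have h2 : d ∣ j := by
    have := hdk.trans (hord ▸ orderOf_dvd_of_pow_eq_one h1)
    exact Nat.dvd_of_mul_dvd_mul_right (Nat.pos_of_ne_zero hk) this
  obtain ⟨c, rfl⟩ := h2
  refine ⟨((g ^ c : Fˣ) : F), Units.ne_zero _, ?_⟩
  have hj' : g ^ (d * c) = Units.mk0 a ha0 := hj
  rw [← Units.val_pow_eq_pow_val, ← pow_mul, mul_comm c d, hj', Units.val_mk0]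

theorem card_sub_one_eq {Q d : ℕ} (hd : 3 * d = Q ^ 2 + Q + 1) (hQ : 1 ≤ Q) :
    Q ^ 3 - 1 = d * (3 * (Q - 1)) := by
  obtain ⟨n, rfl⟩ := Nat.exists_eq_add_of_le' hQ
  rw [Nat.add_sub_cancel]
  have : d * (3 * n) = ((n + 1) ^ 2 + (n + 1) + 1) * n := by rw [← hd]; ring
  rw [this]
  refine Nat.sub_eq_of_eq_add ?_
  ring

theorem IsPaleyClique.ncard_le {F : Type*} [Field F] [Fintype F] {Q d : ℕ} (hQ : 1 < Q)
    (hQ3 : Q % 3 = 1) (hd : 3 * d = Q ^ 2 + Q + 1) (hF : Fintype.card F = Q ^ 3)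
    (φ : F →+* F) (hφ : ∀ a, φ a = a ^ Q) {C : Set F} (hC : IsPaleyClique F d C) :
    C.ncard ≤ Q := by
  have hpow : ∀ a : F, a ^ Q = a ^ (Q - 1) * a := fun a => by
    rw [← pow_succ, Nat.sub_add_cancel hQ.le]
  have key : ∀ z : F, z ≠ 0 → φ ((z ^ d) ^ (Q - 1)) = (z ^ d) ^ (Q - 1) := by
    intro z hz
    have h1 : (((z ^ d) ^ (Q - 1)) ^ 3) = 1 := by
      rw [← pow_mul, ← pow_mul, mul_comm (Q - 1) 3, ← card_sub_one_eq hd hQ.le, ← hF]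
      exact FiniteField.pow_card_sub_one_eq_one z hz
    generalize (z ^ d) ^ (Q - 1) = w at h1
    rw [hφ, ← Nat.div_add_mod Q 3, hQ3, pow_succ, pow_mul, h1, one_pow, one_mul]
  have fixed : ∀ x ∈ C, ∀ y ∈ C, x ≠ y → φ ((x - y) ^ (Q - 1)) = (x - y) ^ (Q - 1) := by
    intro x hx y hy hxy
    obtain ⟨z, hz, h⟩ := hC x hx y hy hxy
    rw [h]
    exact key z hz
  obtain hs | ⟨x, hx, y, hy, hxy⟩ := C.subsingleton_or_nontrivial
  · exact (Set.ncard_le_one_iff_subsingleton.mpr hs).trans hQ.le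
  have hsub : (x - ·) '' C ⊆ {a : F | a ^ Q = (x - y) ^ (Q - 1) * a} := by
    rintro _ ⟨z, hz, rfl⟩
    show (x - z) ^ Q = (x - y) ^ (Q - 1) * (x - z)
    rcases eq_or_ne x z with rfl | hxz
    · simp [(zero_lt_one.trans hQ).ne']
    rcases eq_or_ne z y with rfl | hzy
    · exact hpow _
    have hdiff : (x - y) - (x - z) = z - y := by ring
    rw [hpow, eigenvalue_eq_of_sub φ (sub_ne_zero.mpr hxz) (sub_ne_zero.mpr hxy)
      ((hφ _).trans (hpow _)) ((hφ _).trans (hpow _))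
      (by rw [hdiff]; exact (hφ _).trans (hpow _))
      (fixed x hx y hy hxy) (fixed x hx z hz hxz) (fixed z hz y hy hzy)]
  calc C.ncard = ((x - ·) '' C).ncard :=
        (Set.ncard_image_of_injective C (sub_right_injective)).symm
    _ ≤ _ := Set.ncard_le_ncard hsub (Set.toFinite _)
    _ ≤ Q := ncard_setOf_pow_eq_mul_le hQ _

theorem isPaleyClique_range {F K : Type*} [Field F] [Fintype F] [Field K] [Fintype K] {d : ℕ}
    (hd : d * (Fintype.card K - 1) ∣ Fintype.card F - 1) (f : K →+* F) :
    IsPaleyClique F d (Set.range f) := by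
  rintro _ ⟨u, rfl⟩ _ ⟨v, rfl⟩ huv
  have h : u - v ≠ 0 := sub_ne_zero.mpr fun h => huv (congrArg f h)
  have hK : Fintype.card K - 1 ≠ 0 := by
    have := Fintype.one_lt_card (α := K)
    omega
  refine exists_pow_eq_of_pow_eq_one hK hd (sub_ne_zero.mpr huv) ?_
  rw [← map_sub, ← map_pow, FiniteField.pow_card_sub_one_eq_one _ h, map_one]

theorem stmt11 (p : ℕ) (hp : p.Prime) (hp3 : p % 3 = 1)
    (m : ℕ) (hm : 0 < m) (q : ℕ) (hq : q = p ^ (3 * m))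
    (d : ℕ) (hd : 3 * d = p ^ (2 * m) + p ^ m + 1)
    (F : Type*) [Field F] [Fintype F] (hF : Fintype.card F = q) :
    paleyCliqueNumber F d = p ^ m := by
  have : Fact p.Prime := ⟨hp⟩
  subst hq
  have : CharP F p := charP_of_card_eq_prime_pow hF
  let _ : Algebra (ZMod p) F := ZMod.algebra F p
  have hQ : 1 < p ^ m := Nat.one_lt_pow hm.ne' hp.one_lt
  have hQ3 : p ^ m % 3 = 1 := by simp [Nat.pow_mod, hp3]
  have hd' : 3 * d = (p ^ m) ^ 2 + p ^ m + 1 := by rw [hd, ← pow_mul, mul_comm m 2]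
  have hF' : Fintype.card F = (p ^ m) ^ 3 := by rw [hF, ← pow_mul, mul_comm m 3]
  have hfin : Module.finrank (ZMod p) F = 3 * m := by
    have h := Module.card_eq_pow_finrank (K := ZMod p) (V := F)
    rw [hF, ZMod.card] at h
    exact (Nat.pow_right_injective hp.two_le h).symm
  refine IsGreatest.csSup_eq ⟨?_, ?_⟩
  · obtain ⟨f⟩ := FiniteField.nonempty_algHom_of_finrank_dvd (F := ZMod p) (K := GaloisField p m)
      (L := F) (by rw [GaloisField.finrank p hm.ne', hfin]; exact dvd_mul_left m 3)
    let _ : Fintype (GaloisField p m) := Fintype.ofFinite _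
    have hcard : Fintype.card (GaloisField p m) = p ^ m := by
      rw [← Nat.card_eq_fintype_card, GaloisField.card p m hm.ne']
    refine ⟨Set.range f.toRingHom, isPaleyClique_range ?_ _, ?_⟩
    · rw [hcard, hF', card_sub_one_eq hd' hQ.le]
      exact mul_dvd_mul_left d (dvd_mul_left _ 3)
    · rw [← Set.image_univ, Set.ncard_image_of_injective _ f.toRingHom.injective, Set.ncard_univ,
        GaloisField.card p m hm.ne']
  · rintro n ⟨C, hC, rfl⟩
    exact hC.ncard_le hQ hQ3 hd' hF' (iterateFrobenius F p m) (iterateFrobenius_def p m)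
end

section
/- Let p be an odd prime and let s, t be coprime integers with s > t ≥ 2. Let q = p^{st} and let d = (q-1)(p-1)/((p^s - 1)(p^t - 1)), which is an integer since s and t are coprime. Then ω(GP(q,d)) = p^s. -/
/-- Fewer than `|K|` nonzero vectors of a `K`-vector space avoid the kernel of some functional. -/
theorem exists_dual_forall_mem_ne_zero {K V : Type*} [Field K] [AddCommGroup V] [Module K V]
    (S : Finset V) (hS : ∀ v ∈ S, v ≠ 0) (hcard : (S.card : ℕ∞) < ENat.card K) :
    ∃ f : Module.Dual K V, ∀ v ∈ S, f v ≠ 0 := by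
  have h := Submodule.iUnion_ssubset_of_forall_ne_top_of_card_lt S.attach
    (fun v ↦ LinearMap.ker (Module.Dual.eval K V v.1)) (fun v hv ↦ ?_) (by simpa using hcard)
  · obtain ⟨f, -, hf⟩ := Set.exists_of_ssubset h
    refine ⟨f, fun v hv h0 ↦ hf ?_⟩
    simp only [Set.mem_iUnion]
    exact ⟨⟨v, hv⟩, S.mem_attach _, h0⟩
  · refine hS v v.2 ((Module.forall_dual_apply_eq_zero_iff K v.1).1 fun f ↦ ?_)
    have : f ∈ LinearMap.ker (Module.Dual.eval K V v.1) := hv ▸ Submodule.mem_top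
    exact this

/-- A set whose differences are nonzero multiples of fewer than `|K|` nonzero vectors is separated
by a single functional, and so has at most `|K|` elements. -/
theorem ncard_le_card_of_sub_mem_smul {K V : Type*} [Field K] [Finite K] [AddCommGroup V]
    [Module K V] (S : Finset V) (hS : ∀ v ∈ S, v ≠ 0) (hcard : S.card < Nat.card K) (C : Set V)
    (hC : ∀ x ∈ C, ∀ y ∈ C, x ≠ y → ∃ a : K, a ≠ 0 ∧ ∃ v ∈ S, x - y = a • v) :
    C.ncard ≤ Nat.card K := by
  obtain ⟨f, hf⟩ := exists_dual_forall_mem_ne_zero (K := K) S hS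
    (by rw [ENat.card_eq_coe_natCard]; exact_mod_cast hcard)
  have hinj : Set.InjOn f C := by
    intro x hx y hy hxy
    by_contra hne
    obtain ⟨a, ha, v, hv, h⟩ := hC x hx y hy hne
    have h0 : f (x - y) = 0 := by rw [map_sub, hxy, sub_self]
    rw [h, map_smul, smul_eq_mul] at h0
    exact mul_ne_zero ha (hf v hv) h0
  rw [← Set.ncard_univ, ← hinj.ncard_image]
  exact Set.ncard_le_ncard (Set.subset_univ _)

/-- A `(|K| - 1)`-th root of unity in an extension of a finite field `K` lies in `K`. -/
theorem exists_algebraMap_eq_of_pow_eq_one {K F : Type*} [Field K] [Finite K] [Field F]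
    [Algebra K F] {x : F} (hx : x ^ (Nat.card K - 1) = 1) :
    ∃ a : K, a ≠ 0 ∧ algebraMap K F a = x := by
  classical
  have := Fintype.ofFinite K
  have hn : 0 < Nat.card K - 1 := by have := Finite.one_lt_card (α := K); omega
  have hsub : (Finset.univ.erase (0 : K)).image (algebraMap K F) ⊆
      Polynomial.nthRootsFinset (Nat.card K - 1) (1 : F) := by
    intro y hy
    simp only [Finset.mem_image, Finset.mem_erase] at hy
    obtain ⟨a, ⟨ha, -⟩, rfl⟩ := hy
    rw [Polynomial.mem_nthRootsFinset hn, ← map_pow, Nat.card_eq_fintype_card,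
      FiniteField.pow_card_sub_one_eq_one a ha, map_one]
  have heq := Finset.eq_of_subset_of_card_le hsub (by
    rw [Finset.card_image_of_injective _ (algebraMap K F).injective,
      Finset.card_erase_of_mem (Finset.mem_univ _), Finset.card_univ, ← Nat.card_eq_fintype_card,
      Polynomial.nthRootsFinset]
    exact (Multiset.toFinset_card_le _).trans (Polynomial.card_nthRoots _ _))
  have hx' : x ∈ Polynomial.nthRootsFinset (Nat.card K - 1) (1 : F) :=
    (Polynomial.mem_nthRootsFinset hn _).2 hx
  rw [← heq] at hx'
  simp only [Finset.mem_image, Finset.mem_erase] at hx'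
  obtain ⟨a, ⟨ha, -⟩, h⟩ := hx'
  exact ⟨a, ha, h⟩

/-- In a finite field, an `m`-th root of unity is an `n`-th power when `n * m = |F| - 1`. -/
theorem exists_pow_eq_of_pow_eq_one_s12 {F : Type*} [Field F] [Finite F] {n m : ℕ} (hm : 0 < m)
    (hnm : n * m = Nat.card F - 1) {x : F} (hx : x ^ m = 1) : ∃ z : F, z ≠ 0 ∧ x = z ^ n := by
  have hx0 : x ≠ 0 := by rintro rfl; simp [hm.ne'] at hx
  obtain ⟨g, hg⟩ := IsCyclic.exists_generator (α := Fˣ)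
  obtain ⟨k, hk⟩ := Subgroup.mem_zpowers_iff.1 (hg (Units.mk0 x hx0))
  have hord : orderOf g = n * m := by
    rw [orderOf_eq_card_of_forall_mem_zpowers hg, Nat.card_units, hnm]
  have h1 : g ^ (k * m) = 1 := by
    rw [zpow_mul, hk, zpow_natCast]
    ext
    simpa using hx
  rw [← orderOf_dvd_iff_zpow_eq_one, hord] at h1
  push_cast at h1
  obtain ⟨l, rfl⟩ := Int.dvd_of_mul_dvd_mul_right (by exact_mod_cast hm.ne') h1
  refine ⟨(g ^ l : Fˣ), Units.ne_zero _, ?_⟩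
  rw [← Units.val_pow_eq_pow_val, ← zpow_natCast, ← zpow_mul, mul_comm l, hk, Units.val_mk0]

/-- A `gcd m n`-th power is an `m`-th power times an `n`-th power. -/
theorem exists_pow_gcd_eq_mul {G : Type*} [CommGroup G] (m n : ℕ) (z : G) :
    ∃ a b : G, z ^ m.gcd n = a ^ m * b ^ n := by
  refine ⟨z ^ m.gcdA n, z ^ m.gcdB n, ?_⟩
  rw [← zpow_natCast, ← zpow_natCast, ← zpow_natCast, ← zpow_mul, ← zpow_mul, ← zpow_add,
    Nat.gcd_eq_gcd_ab, mul_comm (m : ℤ), mul_comm (n : ℤ)]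

/-- If `d * (M * N) = Q * gcd M N`, then `d` is the gcd of `Q / M` and `Q / N`. -/
theorem exists_eq_gcd_of_mul_eq_mul_gcd {d M N Q : ℕ} (hM : 0 < M)
    (h : d * (M * N) = Q * M.gcd N) :
    ∃ A B : ℕ, A * M = Q ∧ B * N = Q ∧ d = A.gcd B := by
  have hg : 0 < M.gcd N := Nat.gcd_pos_of_pos_left _ hM
  obtain ⟨m, n, hmn, hm, hn⟩ := Nat.exists_coprime M N
  set g := M.gcd N
  refine ⟨d * n, d * m, ?_, ?_, ?_⟩
  · apply Nat.eq_of_mul_eq_mul_right hg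
    linear_combination h - d * M * hn
  · apply Nat.eq_of_mul_eq_mul_right hg
    linear_combination h - d * N * hm
  · rw [Nat.gcd_mul_left, hmn.symm, mul_one]

theorem stmt12 (p : ℕ) (hp : p.Prime) (hodd : Odd p)
    (s t : ℕ) (hco : Nat.Coprime s t) (hst : t < s) (ht : 2 ≤ t)
    (q : ℕ) (hq : q = p ^ (s * t))
    (d : ℕ) (hd : d * ((p ^ s - 1) * (p ^ t - 1)) = (q - 1) * (p - 1))
    (F : Type*) [Field F] [Fintype F] (hF : Fintype.card F = q) :
    paleyCliqueNumber F d = p ^ s := by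
  classical
  have := Fact.mk hp
  have hFcard : Nat.card F = q := by rw [Nat.card_eq_fintype_card, hF]
  have : CharP F p := charP_of_card_eq_prime_pow (hF.trans hq)
  let _ : Algebra (ZMod p) F := ZMod.algebra F p
  have hKcard : Nat.card (GaloisField p s) = p ^ s := GaloisField.card p s (by omega)
  have hrank : Module.finrank (ZMod p) F = s * t := by
    apply Nat.pow_right_injective hp.two_le
    simp only
    rw [FiniteField.pow_finrank_eq_natCard, hFcard, hq]
  obtain ⟨φ⟩ : Nonempty (GaloisField p s →ₐ[ZMod p] F) :=
    FiniteField.nonempty_algHom_of_finrank_dvd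
      (by rw [GaloisField.finrank p (by omega), hrank]; exact dvd_mul_right s t)
  let _ : Algebra (GaloisField p s) F := φ.toRingHom.toAlgebra
  have hs1 : 0 < p ^ s - 1 := Nat.sub_pos_of_lt (Nat.one_lt_pow (by omega) hp.one_lt)
  have ht1 : 0 < p ^ t - 1 := Nat.sub_pos_of_lt (Nat.one_lt_pow (by omega) hp.one_lt)
  have hlt : p ^ t < p ^ s := Nat.pow_lt_pow_right hp.one_lt hst
  obtain ⟨A, B, hA, hB, rfl⟩ := exists_eq_gcd_of_mul_eq_mul_gcd (d := d) (Q := q - 1) hs1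
    (by rw [hd, Nat.pow_sub_one_gcd_pow_sub_one, hco.gcd_eq_one, pow_one])
  have hroot {k n : ℕ} (h : k * n = q - 1) (u : Fˣ) : ((u : F) ^ k) ^ n = 1 := by
    rw [← pow_mul, h, ← hF, FiniteField.pow_card_sub_one_eq_one _ u.ne_zero]
  refine IsGreatest.csSup_eq ⟨⟨Set.range φ, ?_, ?_⟩, ?_⟩
  · rintro _ ⟨a, rfl⟩ _ ⟨b, rfl⟩ hne
    have hab : a - b ≠ 0 := sub_ne_zero.2 fun h ↦ hne (h ▸ rfl)
    have := Fintype.ofFinite (GaloisField p s)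
    have hpow : (φ a - φ b) ^ (p ^ s - 1) = 1 := by
      rw [← map_sub, ← map_pow, ← hKcard, Nat.card_eq_fintype_card,
        FiniteField.pow_card_sub_one_eq_one _ hab, map_one]
    obtain ⟨z, hz, h⟩ := exists_pow_eq_of_pow_eq_one_s12 hs1 (by rw [hFcard, hA]) hpow
    obtain ⟨e, he⟩ := Nat.gcd_dvd_left A B
    refine ⟨z ^ e, pow_ne_zero _ hz, ?_⟩
    rw [h, ← pow_mul, mul_comm e, ← he]
  · have hφ : Function.Injective φ := φ.toRingHom.injective
    rw [← Set.image_univ, Set.ncard_image_of_injective _ hφ, Set.ncard_univ, hKcard]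
  · rintro _ ⟨C, hC, rfl⟩
    rw [← hKcard]
    refine ncard_le_card_of_sub_mem_smul (Polynomial.nthRootsFinset (p ^ t - 1) (1 : F)) ?_ ?_ C ?_
    · rintro _ hv rfl
      simp [Polynomial.mem_nthRootsFinset ht1, ht1.ne'] at hv
    · rw [hKcard, Polynomial.nthRootsFinset]
      have := (Multiset.toFinset_card_le _).trans (Polynomial.card_nthRoots (p ^ t - 1) (1 : F))
      omega
    · intro x hx y hy hne
      obtain ⟨z, hz, h⟩ := hC x hx y hy hne
      obtain ⟨u, v, huv⟩ := exists_pow_gcd_eq_mul A B (Units.mk0 z hz)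
      obtain ⟨a, ha, hau⟩ := exists_algebraMap_eq_of_pow_eq_one (K := GaloisField p s)
        (x := (u : F) ^ A) (by rw [hKcard, hroot hA])
      refine ⟨a, ha, (v : F) ^ B, (Polynomial.mem_nthRootsFinset ht1 _).2 (hroot hB v), ?_⟩
      rw [h, Algebra.smul_def, hau]
      simpa using congrArg Units.val huv
end

section
/- Let p be an odd prime, q = p^4, and d = 2(p^2 + 1). Then ω(GP(q,d)) = p. -/
/-- In a finite field with `p ^ 4` elements, every `(p - 1)`-st root of unity is a
`2 * (p ^ 2 + 1)`-th power. -/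
lemma exists_eq_pow_of_pow_sub_one_eq_one {F : Type*} [Field F] [Fintype F] {p : ℕ}
    (hp : p.Prime) (hodd : Odd p) (hF : Fintype.card F = p ^ 4) {x : F} (hx0 : x ≠ 0)
    (hx : x ^ (p - 1) = 1) : ∃ z : F, z ≠ 0 ∧ x = z ^ (2 * (p ^ 2 + 1)) := by
  obtain ⟨g, hg⟩ := IsCyclic.exists_generator (α := Fˣ)
  have hord : orderOf g = p ^ 4 - 1 := by
    rw [orderOf_eq_card_of_forall_mem_zpowers hg, Nat.card_units, Nat.card_eq_fintype_card, hF]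
  obtain ⟨k, hk⟩ := (mem_powers_iff_mem_zpowers).mpr (hg (Units.mk0 x hx0))
  have hk : g ^ k = Units.mk0 x hx0 := hk
  have hk1 : g ^ (k * (p - 1)) = 1 := by
    rw [pow_mul, hk]
    ext
    simpa using hx
  have hdvd := orderOf_dvd_of_pow_eq_one hk1
  obtain ⟨m, rfl⟩ := hodd
  have hm : 0 < m := Nat.pos_of_ne_zero fun h ↦ by simp [h, Nat.not_prime_one] at hp
  have hfac : (2 * m + 1) ^ 4 - 1 = 2 * ((2 * m + 1) ^ 2 + 1) * (m + 1) * (2 * m) := by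
    apply Nat.sub_eq_of_eq_add
    ring
  rw [hord, hfac, Nat.add_sub_cancel] at hdvd
  obtain ⟨j, rfl⟩ : 2 * ((2 * m + 1) ^ 2 + 1) ∣ k :=
    (Dvd.intro _ rfl).trans (Nat.dvd_of_mul_dvd_mul_right (by positivity) hdvd)
  refine ⟨((g ^ j : Fˣ) : F), Units.ne_zero _, ?_⟩
  rw [← Units.val_pow_eq_pow_val, ← pow_mul, mul_comm j, hk, Units.val_mk0]

/-- A finite field with `p ^ 4` elements contains an element of the subfield of order `p ^ 2` that
is not a square in that subfield. -/
lemma exists_pow_sq_eq_self_and_pow_half_ne_one {F : Type*} [Field F] [Fintype F] {p : ℕ}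
    (hp : p.Prime) (hodd : Odd p) (hF : Fintype.card F = p ^ 4) :
    ∃ t : F, t ≠ 0 ∧ t ^ p ^ 2 = t ∧ t ^ ((p ^ 2 - 1) / 2) ≠ 1 := by
  obtain ⟨g, hg⟩ := IsCyclic.exists_generator (α := Fˣ)
  have hord : orderOf g = p ^ 4 - 1 := by
    rw [orderOf_eq_card_of_forall_mem_zpowers hg, Nat.card_units, Nat.card_eq_fintype_card, hF]
  obtain ⟨m, rfl⟩ := hodd
  have hm : 0 < m := Nat.pos_of_ne_zero fun h ↦ by simp [h, Nat.not_prime_one] at hp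
  have hhalf : ((2 * m + 1) ^ 2 - 1) / 2 = 2 * m * (m + 1) := by
    rw [show (2 * m + 1) ^ 2 = 2 * (2 * m * (m + 1)) + 1 by ring]
    simp
  have hfac : (2 * m + 1) ^ 4 - 1 = 2 * (((2 * m + 1) ^ 2 + 1) * (2 * m * (m + 1))) := by
    apply Nat.sub_eq_of_eq_add
    ring
  refine ⟨((g ^ ((2 * m + 1) ^ 2 + 1) : Fˣ) : F), Units.ne_zero _, ?_, ?_⟩
  · rw [← Units.val_pow_eq_pow_val, Units.val_inj, ← pow_mul,
      show ((2 * m + 1) ^ 2 + 1) * (2 * m + 1) ^ 2 =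
        2 * (((2 * m + 1) ^ 2 + 1) * (2 * m * (m + 1))) + ((2 * m + 1) ^ 2 + 1) by ring,
      pow_add, ← hfac, ← hord, pow_orderOf_eq_one, one_mul]
  · rw [← Units.val_pow_eq_pow_val, Ne, Units.val_eq_one, ← pow_mul, hhalf]
    have hpos : 0 < ((2 * m + 1) ^ 2 + 1) * (2 * m * (m + 1)) := by positivity
    exact pow_ne_one_of_lt_orderOf hpos.ne' (by rw [hord, hfac]; omega)

/-- In a field of characteristic `p`, a set whose differences are nonzero squares of the subfield
of order `p ^ 2` has at most `p` elements, provided that subfield contains a nonsquare `t`. -/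
lemma ncard_le_of_sub_pow_half_eq_one {F : Type*} [Field F] [Finite F] {p : ℕ} [Fact p.Prime]
    [CharP F p] (hodd : Odd p) {t : F} (ht0 : t ≠ 0) (ht : t ^ p ^ 2 = t)
    (ht1 : t ^ ((p ^ 2 - 1) / 2) ≠ 1) {C : Set F}
    (hC : ∀ x ∈ C, ∀ y ∈ C, x ≠ y → (x - y) ^ ((p ^ 2 - 1) / 2) = 1) : C.ncard ≤ p := by
  obtain rfl | ⟨c, hc⟩ := C.eq_empty_or_nonempty
  · simp
  have hp1 : 1 < p ^ 2 := Nat.one_lt_pow two_ne_zero (Fact.out : p.Prime).one_lt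
  have hhalf : (p ^ 2 - 1) / 2 * 2 + 1 = p ^ 2 := by
    have : Odd (p ^ 2) := hodd.pow
    obtain ⟨k, hk⟩ := this
    omega
  have hfix : ∀ x ∈ C, (x - c) ^ p ^ 2 = x - c := by
    intro x hx
    by_cases h : x = c
    · subst h
      simp [(Fact.out : p.Prime).ne_zero]
    · rw [← hhalf, pow_succ, pow_mul, hC x hx c hc h, one_pow, one_mul]
  let P : Polynomial F := Polynomial.X ^ p ^ 2 - Polynomial.X
  have hP : P ≠ 0 := FiniteField.X_pow_card_sub_X_ne_zero F hp1
  have hroots : (P.rootSet F).ncard ≤ p ^ 2 := by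
    simpa [P, FiniteField.X_pow_card_sub_X_natDegree_eq F hp1] using P.ncard_rootSet_le F
  have hmaps : ∀ z ∈ C ×ˢ C, (z.1 - c) + t * (z.2 - c) ∈ P.rootSet F := by
    rintro ⟨x, y⟩ ⟨hx, hy⟩
    rw [Polynomial.mem_rootSet]
    refine ⟨hP, ?_⟩
    simp only [P, map_sub, map_pow, Polynomial.aeval_X]
    rw [add_pow_char_pow, mul_pow, hfix x hx, hfix y hy, ht, sub_self]
  have hinj : Set.InjOn (fun z : F × F ↦ (z.1 - c) + t * (z.2 - c)) (C ×ˢ C) := by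
    rintro ⟨x, y⟩ ⟨hx, hy⟩ ⟨x', y'⟩ ⟨hx', hy'⟩ h
    have h' : x - x' = t * (y' - y) := by linear_combination h
    by_cases hyy : y' = y
    · subst hyy
      simpa [sub_eq_zero] using h'
    · have hxx : x ≠ x' := by
        rintro rfl
        rw [sub_self, zero_eq_mul] at h'
        exact h'.elim ht0 fun h ↦ hyy (sub_eq_zero.mp h)
      apply absurd _ ht1
      have hpow := hC x hx x' hx' hxx
      rwa [h', mul_pow, hC y' hy' y hy hyy, mul_one] at hpow
  have hcard := Set.ncard_le_ncard_of_injOn _ hmaps hinj (Set.toFinite _)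
  rw [Set.ncard_prod, ← sq] at hcard
  exact (Nat.pow_le_pow_iff_left two_ne_zero).mp (hcard.trans hroots)

theorem stmt13 (p : ℕ) (hp : p.Prime) (hodd : Odd p)
    (q : ℕ) (hq : q = p ^ 4) (d : ℕ) (hd : d = 2 * (p ^ 2 + 1))
    (F : Type*) [Field F] [Fintype F] (hF : Fintype.card F = q) :
    paleyCliqueNumber F d = p := by
  subst hq hd
  have := Fact.mk hp
  have : CharP F p := charP_of_card_eq_prime_pow hF
  refine IsGreatest.csSup_eq ⟨?_, ?_⟩
  · refine ⟨Set.range (ZMod.castHom dvd_rfl F : ZMod p →+* F), ?_, ?_⟩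
    · rintro _ ⟨a, rfl⟩ _ ⟨b, rfl⟩ hab
      have h0 : a - b ≠ 0 := fun h ↦ hab (by rw [sub_eq_zero.mp h])
      rw [← map_sub]
      refine exists_eq_pow_of_pow_sub_one_eq_one hp hodd hF ?_ ?_
      · exact (map_ne_zero _).mpr h0
      · rw [← map_pow, ZMod.pow_card_sub_one_eq_one h0, map_one]
    · rw [← Set.image_univ, Set.ncard_image_of_injective _ (RingHom.injective _), Set.ncard_univ,
        Nat.card_zmod]
  · rintro _ ⟨C, hC, rfl⟩
    obtain ⟨t, ht0, ht, ht1⟩ := exists_pow_sq_eq_self_and_pow_half_ne_one hp hodd hF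
    refine ncard_le_of_sub_pow_half_eq_one hodd ht0 ht ht1 fun x hx y hy hxy ↦ ?_
    obtain ⟨z, hz, h⟩ := hC x hx y hy hxy
    have hexp : 2 * (p ^ 2 + 1) * ((p ^ 2 - 1) / 2) = p ^ 4 - 1 := by
      obtain ⟨k, hk⟩ : Odd (p ^ 2) := hodd.pow
      rw [show p ^ 4 = (p ^ 2) ^ 2 by ring, hk]
      symm
      apply Nat.sub_eq_of_eq_add
      simp only [Nat.add_sub_cancel, ne_eq, OfNat.ofNat_ne_zero, not_false_eq_true,
        mul_div_cancel_left₀]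
      ring
    rw [h, ← pow_mul, hexp, ← hF, FiniteField.pow_card_sub_one_eq_one z hz]
end

section
/- Let p be an odd prime, q = p^4, and d = p^2 + 1. Then ω(GP(q,d)) = p^2, with the subfield F_{p^2} of F_{p^4} forming a maximum clique. -/
theorem IsCyclic.powMonoidHom_range_eq_ker {G : Type*} [CommGroup G] [IsCyclic G] [Finite G]
    {d m : ℕ} (h : Nat.card G = d * m) :
    (powMonoidHom d : G →* G).range = (powMonoidHom m : G →* G).ker := by
  have hpos : 0 < d * m := h ▸ Nat.card_pos
  refine Subgroup.eq_of_le_of_card_ge ?_ (le_of_eq ?_)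
  · rintro _ ⟨z, rfl⟩
    rw [MonoidHom.mem_ker, powMonoidHom_apply, powMonoidHom_apply, ← pow_mul, ← h, pow_card_eq_one']
  · rw [IsCyclic.card_powMonoidHom_range, IsCyclic.card_powMonoidHom_ker, h,
      Nat.gcd_mul_left_left, Nat.gcd_mul_right_left,
      Nat.mul_div_cancel_left _ (Nat.pos_of_mul_pos_right hpos)]

/-- If `Fˣ` has order `d * m` and the nonzero elements of the subfield `K` are the solutions of
`x ^ m = 1`, then they are exactly the nonzero `d`-th powers. -/
theorem Subfield.mem_iff_exists_pow {F : Type*} [Field F] [Finite F] {d m : ℕ}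
    (h : Nat.card Fˣ = d * m) {K : Subfield F} (hK : ∀ u : Fˣ, (u : F) ∈ K ↔ u ^ m = 1)
    {x : F} (hx : x ≠ 0) : x ∈ K ↔ ∃ z : F, z ≠ 0 ∧ x = z ^ d := by
  have key := SetLike.ext_iff.1 (IsCyclic.powMonoidHom_range_eq_ker h) (Units.mk0 x hx)
  rw [MonoidHom.mem_ker, powMonoidHom_apply, ← hK, Units.val_mk0] at key
  rw [← key]
  constructor
  · rintro ⟨z, hz⟩
    exact ⟨z, z.ne_zero, by simpa using (congrArg Units.val hz).symm⟩
  · rintro ⟨z, hz, rfl⟩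
    exact ⟨Units.mk0 z hz, Units.ext (by simp)⟩

theorem Subfield.card_of_mem_iff_pow_eq_one {F : Type*} [Field F] [Finite F] {d m : ℕ}
    (h : Nat.card Fˣ = d * m) {K : Subfield F} (hK : ∀ u : Fˣ, (u : F) ∈ K ↔ u ^ m = 1) :
    Nat.card K = m + 1 := by
  have hset : (K : Set F) =
      insert 0 (Units.val '' ((powMonoidHom m : Fˣ →* Fˣ).ker : Set Fˣ)) := by
    ext x
    rcases eq_or_ne x 0 with rfl | hx
    · simp
    · have := hK (Units.mk0 x hx)
      rw [Units.val_mk0] at this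
      simp only [SetLike.mem_coe, this, Set.mem_insert_iff, hx, false_or, Set.mem_image,
        MonoidHom.mem_ker, powMonoidHom_apply]
      constructor
      · exact fun hu => ⟨_, hu, rfl⟩
      · rintro ⟨u, hu, rfl⟩
        simpa using hu
  have hcard : Nat.card K = (K : Set F).ncard := rfl
  rw [hcard, hset, Set.ncard_insert_of_notMem (by simp) (Set.toFinite _),
    Set.ncard_image_of_injective _ Units.val_injective]
  congr 1
  exact (IsCyclic.card_powMonoidHom_ker Fˣ m).trans (by rw [h, Nat.gcd_mul_left_left])

/-- If the nonzero `d`-th powers are the nonzero elements of a subfield `K`, every clique of the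
`d`-Paley graph lies in a translate of `K`. -/
theorem IsPaleyClique.ncard_le_s14 {F : Type*} [Field F] [Finite F] {d : ℕ} {K : Subfield F}
    (hK : ∀ x : F, x ≠ 0 → (x ∈ K ↔ ∃ z : F, z ≠ 0 ∧ x = z ^ d)) {C : Set F}
    (hC : IsPaleyClique F d C) : C.ncard ≤ Nat.card K := by
  rcases C.eq_empty_or_nonempty with rfl | ⟨c, hc⟩
  · simp
  · refine Set.ncard_le_ncard_of_injOn (t := (K : Set F)) (· - c) (fun x hx => ?_)
      sub_left_injective.injOn (Set.toFinite _)
    rcases eq_or_ne x c with rfl | hne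
    · simp
    · exact (hK _ (sub_ne_zero.2 hne)).2 (hC x hx c hc hne)

theorem isPaleyClique_subfield {F : Type*} [Field F] {d : ℕ} {K : Subfield F}
    (hK : ∀ x : F, x ≠ 0 → (x ∈ K ↔ ∃ z : F, z ≠ 0 ∧ x = z ^ d)) :
    IsPaleyClique F d (K : Set F) :=
  fun _ hx _ hy hne => (hK _ (sub_ne_zero.2 hne)).1 (K.sub_mem hx hy)

theorem paleyCliqueNumber_eq_card_subfield {F : Type*} [Field F] [Finite F] {d : ℕ}
    {K : Subfield F} (hK : ∀ x : F, x ≠ 0 → (x ∈ K ↔ ∃ z : F, z ≠ 0 ∧ x = z ^ d)) :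
    paleyCliqueNumber F d = Nat.card K := by
  refine IsGreatest.csSup_eq ⟨⟨K, isPaleyClique_subfield hK, rfl⟩, ?_⟩
  rintro _ ⟨C, hC, rfl⟩
  exact hC.ncard_le_s14 hK

theorem stmt14 (p : ℕ) (hp : p.Prime) (hodd : Odd p)
    (q : ℕ) (hq : q = p ^ 4) (d : ℕ) (hd : d = p ^ 2 + 1)
    (F : Type*) [Field F] [Fintype F] (hF : Fintype.card F = q) :
    paleyCliqueNumber F d = p ^ 2 ∧
      ∃ K : Subfield F, Nat.card K = p ^ 2 ∧ IsPaleyClique F d (K : Set F) := by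
  have : Fact p.Prime := ⟨hp⟩
  have : CharP F p := charP_of_card_eq_prime_pow (hF.trans hq)
  obtain ⟨m, hm⟩ : ∃ m, p ^ 2 = m + 1 :=
    Nat.exists_eq_succ_of_ne_zero (pow_ne_zero 2 hp.ne_zero)
  have hunits : Nat.card Fˣ = d * m := by
    rw [Nat.card_units, Nat.card_eq_fintype_card, hF, hq, hd, show p ^ 4 = (p ^ 2) ^ 2 by ring, hm,
      Nat.sub_eq_iff_eq_add (Nat.one_le_pow _ _ m.succ_pos)]
    rw [Nat.succ_eq_add_one]
    ring
  let K : Subfield F := (iterateFrobenius F p 2).eqLocusField (RingHom.id F)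
  have hK (u : Fˣ) : (u : F) ∈ K ↔ u ^ m = 1 := by
    rw [RingHom.mem_eqLocusField, iterateFrobenius_def, hm, RingHom.id_apply, Units.ext_iff,
      pow_succ, mul_eq_right₀ u.ne_zero, Units.val_pow_eq_pow_val, Units.val_one]
  have hpow (x : F) (hx : x ≠ 0) := Subfield.mem_iff_exists_pow hunits hK hx
  have hcard : Nat.card K = p ^ 2 :=
    (Subfield.card_of_mem_iff_pow_eq_one hunits hK).trans hm.symm
  exact ⟨(paleyCliqueNumber_eq_card_subfield hpow).trans hcard, K, hcard,
    isPaleyClique_subfield hpow⟩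
end

section
/- Let x be a positive integer and suppose p = 2x^2 + x + 1 is prime. Then d = 4x^2 + 3 is a divisor of p^2 + p + 1 with d > p, and consequently ω(GP(p^3, d)) = p. (In particular, the identity (4x^2+3)(x^2+x+1) = (2x^2+x+1)^2 + (2x^2+x+1) + 1 holds for all integers x.) -/
/-- Given `n + 1` distinct points, some linear combination of evaluations at them annihilates
all monomials of degree less than `n` and maps the monomial of degree `n` to `1`. -/
theorem exists_weights_sum_mul_pow {F : Type*} [Field F] {n : ℕ} {v : Fin (n + 1) → F}
    (hv : Function.Injective v) :
    ∃ c : Fin (n + 1) → F, ∀ j ≤ n, ∑ i, c i * v i ^ j = if j = n then 1 else 0 := by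
  have hdet : IsUnit (Matrix.vandermonde v).det :=
    (Matrix.det_vandermonde_ne_zero_iff.mpr hv).isUnit
  refine ⟨Matrix.vecMul (Pi.single (Fin.last n) 1) (Matrix.vandermonde v)⁻¹, fun j hj => ?_⟩
  have h : Matrix.vecMul (Matrix.vecMul (Pi.single (Fin.last n) 1) (Matrix.vandermonde v)⁻¹)
      (Matrix.vandermonde v) = Pi.single (Fin.last n) 1 := by
    rw [Matrix.vecMul_vecMul, Matrix.nonsing_inv_mul _ hdet, Matrix.vecMul_one]
  have h2 := congrFun h ⟨j, Nat.lt_succ_of_le hj⟩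
  simp only [Matrix.vecMul, dotProduct, Matrix.vandermonde_apply, Pi.single_apply,
    Fin.ext_iff, Fin.val_last] at h2 ⊢
  exact h2

/-- The moment conditions on the weights are translation invariant. -/
theorem sum_mul_add_pow_of_moments {F ι : Type*} [Field F] [Fintype ι] {n : ℕ} {c v : ι → F}
    (hc : ∀ j ≤ n, ∑ i, c i * v i ^ j = if j = n then 1 else 0) (a : F) {r : ℕ} (hr : r ≤ n) :
    ∑ i, c i * (a + v i) ^ r = if r = n then 1 else 0 := by
  simp_rw [add_comm a, add_pow, Finset.mul_sum]
  rw [Finset.sum_comm]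
  have h : ∀ j ∈ Finset.range (r + 1), ∑ i, c i * (v i ^ j * a ^ (r - j) * (r.choose j : F)) =
      if j = n then 1 else 0 := by
    intro j hj
    have hjr : j ≤ r := Finset.mem_range_succ_iff.mp hj
    have : ∑ i, c i * (v i ^ j * a ^ (r - j) * (r.choose j : F)) =
        (∑ i, c i * v i ^ j) * (a ^ (r - j) * (r.choose j : F)) := by
      rw [Finset.sum_mul]
      exact Finset.sum_congr rfl fun i _ => by ring
    rw [this, hc j (hjr.trans hr)]
    split_ifs with hjn
    · obtain rfl : r = j := by omega
      simp
    · simp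
  rw [Finset.sum_congr rfl h, Finset.sum_ite_eq']
  simp only [Finset.mem_range]
  exact if_congr (by omega) rfl rfl

open Polynomial in
/-- The Stepanov method: a bound for sets whose nonzero differences are `m`-th roots of unity. -/
theorem mul_card_le_of_sub_pow_eq_one {F : Type*} [Field F] (p : ℕ) [Fact p.Prime] [CharP F p]
    {A : Finset F} {m n : ℕ} (hm : 0 < m)
    (hA : ∀ a ∈ A, ∀ b ∈ A, a ≠ b → (a - b) ^ m = 1) (hnA : n + 1 ≤ A.card)
    (hnp : n ≤ p) (hchoose : ((m + n).choose m : F) ≠ 0) :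
    n * A.card ≤ m := by
  classical
  obtain ⟨B, hBA, hB⟩ := Finset.exists_subset_card_eq hnA
  let e := (B.equivFinOfCardEq hB).symm
  let v : Fin (n + 1) → F := fun i => -(e i : F)
  have hv : Function.Injective v := fun i j hij =>
    e.injective (Subtype.ext (neg_injective hij))
  have hvA : ∀ i, -v i ∈ A := fun i => by
    simpa [v] using hBA (e i).2
  obtain ⟨c, hc⟩ := exists_weights_sum_mul_pow hv
  have hpow : ∀ a ∈ A, ∀ i, ∀ r ≠ 0, (a + v i) ^ (m + r) = (a + v i) ^ r := by
    intro a ha i r hr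
    by_cases h : a = -v i
    · simp [h, hr]
    · have := hA a ha _ (hvA i) h
      rw [sub_neg_eq_add] at this
      rw [pow_add, this, one_mul]
  let f : F[X] := ∑ i, C (c i) * (X + C (v i)) ^ (m + n) - C 1
  have hcoeff : ∀ s, m ≤ s → s ≤ m + n →
      f.coeff s = if s = m then ((m + n).choose m : F) else 0 := by
    intro s hs hsn
    have h1 : f.coeff s = (∑ i, c i * v i ^ (m + n - s)) * ((m + n).choose s : F) := by
      simp only [f, coeff_sub, finsetSum_coeff, coeff_C_mul, coeff_X_add_C_pow, coeff_C,
        if_neg (show s ≠ 0 by omega), sub_zero, Finset.sum_mul, mul_assoc]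
    rw [h1, hc _ (by omega)]
    by_cases h : s = m
    · subst h; simp
    · rw [if_neg h, if_neg (by omega), zero_mul]
  have hdeg : f.natDegree ≤ m := by
    have hle : f.natDegree ≤ m + n := by
      refine (natDegree_sub_le_iff_left (by simp)).mpr
        (natDegree_sum_le_of_forall_le _ _ fun i _ => ?_)
      refine (natDegree_C_mul_le _ _).trans ?_
      rw [natDegree_pow, natDegree_X_add_C, mul_one]
    rw [natDegree_le_iff_coeff_eq_zero]
    intro s hs
    by_cases h : s ≤ m + n
    · rw [hcoeff s hs.le h, if_neg hs.ne']
    · exact coeff_eq_zero_of_natDegree_lt (by omega)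
  rcases Nat.eq_zero_or_pos n with rfl | hn
  · simp
  have hf : f ≠ 0 := by
    intro h
    have := hcoeff m le_rfl (by omega)
    rw [h, coeff_zero, if_pos rfl] at this
    exact hchoose this.symm
  have hder : ∀ a ∈ A, ∀ j < n, (derivative^[j] f).IsRoot a := by
    intro a ha j hj
    have h1 : (derivative^[j] (∑ i, C (c i) * (X + C (v i)) ^ (m + n))).eval a =
        ((m + n).descFactorial j : F) * ∑ i, c i * (a + v i) ^ (n - j) := by
      rw [iterate_derivative_sum, eval_finsetSum, Finset.mul_sum]
      refine Finset.sum_congr rfl fun i _ => ?_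
      rw [iterate_derivative_C_mul, iterate_derivative_X_add_pow, eval_mul, eval_C,
        eval_smul, eval_pow, eval_add, eval_X, eval_C, Nat.add_sub_assoc hj.le,
        hpow a ha i _ (by omega), nsmul_eq_mul]
      ring
    rw [IsRoot.def]
    simp only [f, iterate_derivative_sub, eval_sub, h1]
    rw [sum_mul_add_pow_of_moments hc a (Nat.sub_le n j)]
    rcases Nat.eq_zero_or_pos j with rfl | hj0
    · simp
    · rw [if_neg (by omega), iterate_derivative_C hj0]
      simp
  have hmult : ∀ a ∈ A, n ≤ f.rootMultiplicity a := by
    intro a ha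
    obtain ⟨k, rfl⟩ : ∃ k, n = k + 1 := ⟨n - 1, by omega⟩
    refine (lt_rootMultiplicity_iff_isRoot_iterate_derivative_of_mem_nonZeroDivisors hf ?_).mpr
      fun j hj => hder a ha j (by omega)
    rw [mem_nonZeroDivisors_iff_ne_zero, Ne, CharP.cast_eq_zero_iff F p,
      (Fact.out : p.Prime).dvd_factorial]
    omega
  have hle : n • A.val ≤ f.roots := by
    rw [Multiset.le_iff_count]
    intro a
    rw [Multiset.count_nsmul, count_roots]
    by_cases ha : a ∈ A
    · rw [Multiset.count_eq_one_of_mem A.nodup ha]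
      simpa using hmult a ha
    · rw [Multiset.count_eq_zero_of_notMem ha]
      simp
  have := Multiset.card_le_card hle
  rw [Multiset.card_nsmul] at this
  exact this.trans ((card_roots' f).trans hdeg)

theorem IsCyclic.exists_pow_eq_of_pow_eq_one {G : Type*} [Group G] [IsCyclic G] {s t : ℕ}
    (hs : s ≠ 0) (hG : Nat.card G = s * t) {w : G} (hw : w ^ s = 1) : ∃ z : G, z ^ t = w := by
  obtain ⟨g, hg⟩ := IsCyclic.exists_generator (α := G)
  obtain ⟨i, rfl⟩ := Subgroup.mem_zpowers_iff.mp (hg w)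
  rw [← zpow_natCast, ← zpow_mul, ← orderOf_dvd_iff_zpow_eq_one,
    orderOf_eq_card_of_forall_mem_zpowers hg, hG, mul_comm i, Nat.cast_mul] at hw
  obtain ⟨l, rfl⟩ := Int.dvd_of_mul_dvd_mul_left (by exact_mod_cast hs) hw
  exact ⟨g ^ l, by rw [← zpow_natCast, ← zpow_mul, mul_comm]⟩

theorem Nat.Prime.not_dvd_choose_mul_sub_one {p k : ℕ} (hp : p.Prime) (hk : 0 < k) (hkp : k ≤ p) :
    ¬ p ∣ ((p - 1) * k + (k - 1)).choose ((p - 1) * k) := by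
  intro h
  rw [Nat.choose_symm_add] at h
  have h2 : p ∣ ((p - 1) * k + 1).ascFactorial (k - 1) := by
    rw [Nat.ascFactorial_eq_factorial_mul_choose]
    exact h.mul_left _
  rw [Nat.ascFactorial_eq_prod_range, hp.prime.dvd_finsetProd_iff] at h2
  obtain ⟨i, hi, hd⟩ := h2
  rw [Finset.mem_range] at hi
  obtain ⟨r, rfl⟩ : ∃ r, p = r + 1 := ⟨p - 1, by have := hp.pos; omega⟩
  have h3 : (r + 1 - 1) * k + 1 + i + (k - 1 - i) = (r + 1) * k := by
    rw [Nat.add_sub_cancel, add_mul]; omega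
  have h4 : r + 1 ∣ k - 1 - i := (Nat.dvd_add_right hd).mp (h3 ▸ dvd_mul_right _ _)
  have := Nat.le_of_dvd (by omega) h4
  omega

/-- The prime field is a clique of the `d`-Paley graph on `F` when `d ∣ (|F| - 1) / (p - 1)`. -/
theorem isPaleyClique_range_algebraMap {F : Type*} [Field F] [Fintype F] {p d e : ℕ}
    [Fact p.Prime] [Algebra (ZMod p) F] (hF : Fintype.card F - 1 = (p - 1) * (e * d)) :
    IsPaleyClique F d (Set.range (algebraMap (ZMod p) F)) := by
  have hp := (Fact.out : p.Prime).two_le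
  rintro _ ⟨a, rfl⟩ _ ⟨b, rfl⟩ hab
  have hw : a - b ≠ 0 := sub_ne_zero.mpr fun h => hab (congrArg _ h)
  let w : Fˣ := Units.map (algebraMap (ZMod p) F).toMonoidHom (Units.mk0 (a - b) hw)
  have hcard : Nat.card Fˣ = (p - 1) * (e * d) := by
    rw [Nat.card_units, Nat.card_eq_fintype_card, hF]
  have hw1 : w ^ (p - 1) = 1 := by
    rw [← map_pow, ZMod.units_pow_card_sub_one_eq_one, map_one]
  obtain ⟨z, hz⟩ := IsCyclic.exists_pow_eq_of_pow_eq_one (by omega) hcard hw1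
  refine ⟨((z ^ e : Fˣ) : F), Units.ne_zero _, ?_⟩
  rw [← Units.val_pow_eq_pow_val, ← pow_mul, hz, ← map_sub]
  rfl

theorem stmt16 (x : ℕ) (hx : 0 < x)
    (p : ℕ) (hpx : p = 2 * x ^ 2 + x + 1) (hp : p.Prime)
    (F : Type*) [Field F] [Fintype F] (hF : Fintype.card F = p ^ 3) :
    (4 * x ^ 2 + 3) ∣ (p ^ 2 + p + 1) ∧ p < 4 * x ^ 2 + 3 ∧
      paleyCliqueNumber F (4 * x ^ 2 + 3) = p ∧
      ∀ y : ℤ, (4 * y ^ 2 + 3) * (y ^ 2 + y + 1) =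
        (2 * y ^ 2 + y + 1) ^ 2 + (2 * y ^ 2 + y + 1) + 1 := by
  have hd : p ^ 2 + p + 1 = (x ^ 2 + x + 1) * (4 * x ^ 2 + 3) := by
    subst hpx; ring
  refine ⟨Dvd.intro_left _ hd.symm, by nlinarith, ?_, fun y => by ring⟩
  have : Fact p.Prime := ⟨hp⟩
  have : CharP F p := charP_of_card_eq_prime_pow hF
  let _ : Algebra (ZMod p) F := ZMod.algebra F p
  have hFd : Fintype.card F - 1 = (p - 1) * ((x ^ 2 + x + 1) * (4 * x ^ 2 + 3)) := by
    rw [hF, ← hd]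
    obtain ⟨r, rfl⟩ : ∃ r, p = r + 1 := ⟨p - 1, by have := hp.pos; omega⟩
    rw [Nat.add_sub_cancel]
    exact Nat.sub_eq_of_eq_add (by ring)
  refine IsGreatest.csSup_eq ⟨⟨_, isPaleyClique_range_algebraMap hFd, ?_⟩, ?_⟩
  · rw [← Set.image_univ, Set.ncard_image_of_injective _ (algebraMap (ZMod p) F).injective,
      Set.ncard_univ, Nat.card_zmod]
  rintro _ ⟨S, hS, rfl⟩
  by_contra! hlt
  have hkp : x ^ 2 + x + 1 ≤ p := by nlinarith
  rw [Set.ncard_eq_toFinset_card S] at hlt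
  have hbound := mul_card_le_of_sub_pow_eq_one (F := F) p (A := S.toFinite.toFinset)
    (m := (p - 1) * (x ^ 2 + x + 1)) (n := x ^ 2 + x + 1 - 1)
    (Nat.mul_pos (by omega) (by omega)) ?_ (by omega) (by omega) ?_
  · rw [Nat.add_sub_cancel] at hbound
    have h1 : (x ^ 2 + x) * (p + 1) ≤ (p - 1) * (x ^ 2 + x + 1) :=
      (Nat.mul_le_mul_left _ hlt).trans hbound
    rw [hpx, Nat.add_sub_cancel] at h1
    nlinarith
  · intro a ha b hb hab
    rw [Set.Finite.mem_toFinset] at ha hb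
    obtain ⟨z, hz, h⟩ := hS a ha b hb hab
    rw [h, ← pow_mul, ← FiniteField.pow_card_sub_one_eq_one z hz, hFd]
    congr 1
    ring
  · rw [Ne, CharP.cast_eq_zero_iff F p]
    exact hp.not_dvd_choose_mul_sub_one (by omega) hkp
end
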